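/- Let p be a prime, F a field of characteristic p, and A a central simple F-algebra with exp A = p. Let n be a positive integer and assume that A splits over a p-extension of F of degree p^n. Then λ_p(A) ≤ 2·p^{n−1} − 1. -/

import Mathlib

open scoped TensorProduct

/-- A finite-dimensional central simple algebra over a field `F`. -/
def IsCSA (F A : Type) [Field F] [Ring A] [Algebra F A] : Prop :=
  Algebra.IsCentral F A ∧ IsSimpleRing A ∧ FiniteDimensional F A

/-- An `F`-algebra is split if it is isomorphic to a matrix algebra over `F`. -/
def IsSplitAlg (F A : Type) [Field F] [Ring A] [Algebra F A] : Prop :=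
  ∃ n : ℕ, 0 < n ∧ Nonempty (A ≃ₐ[F] Matrix (Fin n) (Fin n) F)

/-- Brauer equivalence of two algebras over a field `F`. -/
def IsBrauerEquiv (F A B : Type) [Field F] [Ring A] [Algebra F A] [Ring B] [Algebra F B] :
    Prop :=
  ∃ n m : ℕ, 0 < n ∧ 0 < m ∧
    Nonempty ((Matrix (Fin n) (Fin n) A) ≃ₐ[F] (Matrix (Fin m) (Fin m) B))

/-- `A` has exponent `e`: `e` is the least positive integer such that the `e`-fold tensor
power of `A` over `F` is split. -/
def HasExponent (F A : Type) [Field F] [Ring A] [Algebra F A] (e : ℕ) : Prop :=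
  0 < e ∧ IsSplitAlg F (⨂[F] _ : Fin e, A) ∧
    ∀ k : ℕ, 0 < k → IsSplitAlg F (⨂[F] _ : Fin k, A) → e ≤ k

/-- `A` has (Schur) index `d`: `A` is isomorphic to a matrix algebra over a division
algebra of dimension `d ^ 2` over `F`. -/
def HasIndex (F A : Type) [Field F] [Ring A] [Algebra F A] (d : ℕ) : Prop :=
  ∃ (D : Type) (_ : DivisionRing D) (_ : Algebra F D) (m : ℕ), 0 < m ∧
    Nonempty (A ≃ₐ[F] Matrix (Fin m) (Fin m) D) ∧ Module.finrank F D = d ^ 2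

/-- The (Schur) index of `A` is at most `d`. -/
def IndexLE (F A : Type) [Field F] [Ring A] [Algebra F A] (d : ℕ) : Prop :=
  ∃ e : ℕ, e ≤ d ∧ HasIndex F A e

/-- `A` is the cyclic (symbol) algebra `[a, b)_{p,F}` of degree `p` in characteristic `p`:
it has dimension `p ^ 2` over `F` and is generated by elements `i`, `j` subject to
`i ^ p - i = a`, `j ^ p = b`, `j * i = (i - 1) * j`. -/
def IsCyclicAlgWith (p : ℕ) (F A : Type) [Field F] [Ring A] [Algebra F A] (a b : F) : Prop :=
  b ≠ 0 ∧ Module.finrank F A = p ^ 2 ∧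
    ∃ i j : A, i ^ p - i = algebraMap F A a ∧ j ^ p = algebraMap F A b ∧
      j * i = (i - 1) * j ∧ Algebra.adjoin F {i, j} = ⊤

/-- `A` is a cyclic algebra of degree `p`, i.e. of the form `[a, b)_{p,F}`. -/
def IsCyclicPAlg (p : ℕ) (F A : Type) [Field F] [Ring A] [Algebra F A] : Prop :=
  ∃ a b : F, IsCyclicAlgWith p F A a b

/-- The `p`-symbol length of `A` is at most `m`: `A` is Brauer equivalent to a tensor
product of at most `m` cyclic `F`-algebras of degree `p`. -/
def SymbolLengthLE (p : ℕ) (F A : Type) [Field F] [Ring A] [Algebra F A] (m : ℕ) : Prop :=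
  ∃ k : ℕ, k ≤ m ∧ ∃ (D : Fin k → Type) (_ : ∀ i, Ring (D i)) (_ : ∀ i, Algebra F (D i)),
    (∀ i, IsCyclicPAlg p F (D i)) ∧ IsBrauerEquiv F A (⨂[F] i, D i)

/-- `M` is a compositum `LK` of `L` and `K` over `F`: it is generated as an `F`-algebra by
the images of `L` and `K`. -/
def IsCompositum (F L K M : Type) [Field F] [Field L] [Field K] [Field M]
    [Algebra F L] [Algebra F K] [Algebra F M] [Algebra L M] [Algebra K M]
    [IsScalarTower F L M] [IsScalarTower F K M] : Prop :=
  (IsScalarTower.toAlgHom F L M).range ⊔ (IsScalarTower.toAlgHom F K M).range = ⊤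

/-- A cyclic algebra of degree `m` over `F`: a central simple `F`-algebra of degree `m`
containing a cyclic field extension of `F` of degree `m` (as a maximal subfield). -/
def IsCyclicAlgebra (F A : Type) [Field F] [Ring A] [Algebra F A] (m : ℕ) : Prop :=
  IsCSA F A ∧ Module.finrank F A = m ^ 2 ∧
  ∃ (L : Type) (_ : Field L) (_ : Algebra F L), IsGalois F L ∧ IsCyclic (L ≃ₐ[F] L) ∧
    Module.finrank F L = m ∧ Nonempty (L →ₐ[F] A)

/-- `L/F` is a `p`-extension: there is a tower of intermediate fields from `F` to `L`
each step of which is a cyclic extension of degree `p`. -/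
def IsPExtension (p : ℕ) (F L : Type) [Field F] [Field L] [Algebra F L] : Prop :=
  ∃ (n : ℕ) (T : Fin (n + 1) → IntermediateField F L),
    T 0 = ⊥ ∧ T (Fin.last n) = ⊤ ∧
    ∀ i : Fin n, ∃ h : T i.castSucc ≤ T i.succ,
      IsGalois (T i.castSucc) (IntermediateField.extendScalars h) ∧
      IsCyclic ((IntermediateField.extendScalars h) ≃ₐ[T i.castSucc]
        (IntermediateField.extendScalars h)) ∧
      Module.finrank (T i.castSucc) (IntermediateField.extendScalars h) = p

/-- `F` is `p`-cyclic reducible: for every central simple `F`-algebra `A` of exponent `p`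
and every purely inseparable extension `K/F` with `K ^ p ⊆ F`, either `A_K` is split, or
there is a separable extension `L/F` of degree `ind (A_K) / p` such that `A_{LK}` is
Brauer equivalent to a cyclic `LK`-algebra of degree `p`. -/
def IsPCyclicReducible (p : ℕ) (F : Type) [Field F] : Prop :=
  ∀ (A : Type) [Ring A] [Algebra F A], IsCSA F A → HasExponent F A p →
  ∀ (K : Type) [Field K] [Algebra F K], IsPurelyInseparable F K →
    (∀ z : K, z ^ p ∈ (algebraMap F K).range) →
    IsSplitAlg K (K ⊗[F] A) ∨
    ∃ d : ℕ, HasIndex K (K ⊗[F] A) (p * d) ∧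
      ∃ (L : Type) (_ : Field L) (_ : Algebra F L), Algebra.IsSeparable F L ∧
        Module.finrank F L = d ∧
        ∃ (M : Type) (_ : Field M) (_ : Algebra F M) (_ : Algebra L M) (_ : Algebra K M)
          (_ : IsScalarTower F L M) (_ : IsScalarTower F K M),
          IsCompositum F L K M ∧
          ∃ (C : Type) (_ : Ring C) (_ : Algebra M C),
            IsCyclicPAlg p M C ∧ IsBrauerEquiv M (M ⊗[F] A) C

/-- `F` is `p`-reducible: for every central simple `F`-algebra `A` of exponent `p`
and every purely inseparable extension `K/F` with `K ^ p ⊆ F`, either `A_K` is split, or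
there is a separable extension `L/F` of degree `ind (A_K) / p` with `ind A_{LK} = p`. -/
def IsPReducible (p : ℕ) (F : Type) [Field F] : Prop :=
  ∀ (A : Type) [Ring A] [Algebra F A], IsCSA F A → HasExponent F A p →
  ∀ (K : Type) [Field K] [Algebra F K], IsPurelyInseparable F K →
    (∀ z : K, z ^ p ∈ (algebraMap F K).range) →
    IsSplitAlg K (K ⊗[F] A) ∨
    ∃ d : ℕ, HasIndex K (K ⊗[F] A) (p * d) ∧
      ∃ (L : Type) (_ : Field L) (_ : Algebra F L), Algebra.IsSeparable F L ∧
        Module.finrank F L = d ∧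
        ∃ (M : Type) (_ : Field M) (_ : Algebra F M) (_ : Algebra L M) (_ : Algebra K M)
          (_ : IsScalarTower F L M) (_ : IsScalarTower F K M),
          IsCompositum F L K M ∧ HasIndex M (M ⊗[F] A) p

open Module

section Conjugation

variable {F A N : Type*} [Field F] [Ring A] [Algebra F A] [Field N] [Algebra F N]
  {X Y : Type*} [Fintype X] [DecidableEq X] [Fintype Y] [DecidableEq Y]

lemma linearIndependent_comp_basis_of_span_range_eq_top {ι : Type*} [Fintype ι]
    (b : Basis ι F A) (f : A →ₐ[F] Matrix X X N)
    (hf : Submodule.span N (Set.range f) = ⊤) (hA : finrank F A = Fintype.card X ^ 2) :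
    LinearIndependent N (f ∘ b) ∧ ⊤ ≤ Submodule.span N (Set.range (f ∘ b)) := by
  have hspan : ⊤ ≤ Submodule.span N (Set.range (f ∘ b)) := by
    rw [← hf, Submodule.span_le]
    rintro _ ⟨a, rfl⟩
    rw [← b.sum_repr a, map_sum]
    refine Submodule.sum_mem _ fun i _ => ?_
    rw [map_smul, ← algebraMap_smul N]
    exact Submodule.smul_mem _ _ (Submodule.subset_span ⟨i, rfl⟩)
  refine ⟨linearIndependent_of_top_le_span_of_card_eq_finrank hspan ?_, hspan⟩
  rw [← finrank_eq_card_basis b, hA, finrank_matrix]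
  simp [sq]

/-- Two representations of an algebra on matrices of the right size are conjugate as soon as the
first one is absolutely irreducible. -/
lemma exists_conj_of_span_range_eq_top [Nonempty X] (f : A →ₐ[F] Matrix X X N)
    (hf : Submodule.span N (Set.range f) = ⊤) (hA : finrank F A = Fintype.card X ^ 2)
    (hXY : Fintype.card X = Fintype.card Y) (g : A →ₐ[F] Matrix Y Y N) :
    ∃ (P : Matrix Y X N) (Q : Matrix X Y N), P * Q = 1 ∧ Q * P = 1 ∧
      ∀ a, g a = P * f a * Q := by
  have : FiniteDimensional F A := FiniteDimensional.of_finrank_pos (by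
    rw [hA]; have := Fintype.card_pos (α := X); positivity)
  let b := finBasis F A
  obtain ⟨hli, hspan⟩ := linearIndependent_comp_basis_of_span_range_eq_top b f hf hA
  let B : Basis _ N (Matrix X X N) := Basis.mk hli hspan
  let φ : Matrix X X N →ₗ[N] Matrix Y Y N := B.constr N (g ∘ b)
  have hφ : ∀ a, φ (f a) = g a := by
    intro a
    have h : ∀ i, φ (f (b i)) = g (b i) := fun i => by
      have := B.constr_basis N (g ∘ b) i
      simpa [B, φ] using this
    conv_lhs => rw [← b.sum_repr a]
    conv_rhs => rw [← b.sum_repr a]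
    simp only [map_sum, map_smul]
    refine Finset.sum_congr rfl fun i _ => ?_
    rw [← algebraMap_smul N, map_smul, h, algebraMap_smul]
  have hmul : ∀ x y, φ (x * y) = φ x * φ y := by
    intro x y
    have hx : x ∈ Submodule.span N (Set.range f) := by rw [hf]; trivial
    have hy : y ∈ Submodule.span N (Set.range f) := by rw [hf]; trivial
    induction hx, hy using Submodule.span_induction₂ with
    | mem_mem x y hx hy =>
      obtain ⟨a, rfl⟩ := hx
      obtain ⟨c, rfl⟩ := hy
      rw [← map_mul, hφ, hφ, hφ, map_mul]
    | zero_left => simp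
    | zero_right => simp
    | add_left _ _ _ _ _ _ h1 h2 => simp [add_mul, h1, h2]
    | add_right _ _ _ _ _ _ h1 h2 => simp [mul_add, h1, h2]
    | smul_left _ _ _ _ _ h => simp [h]
    | smul_right _ _ _ _ _ h => simp [h]
  let Φ : Matrix X X N →ₐ[N] Matrix Y Y N :=
    AlgHom.ofLinearMap φ (by rw [← map_one f, hφ, map_one]) hmul
  have : Nonempty Y := Fintype.card_pos_iff.mp (hXY ▸ Fintype.card_pos)
  have hbij : Function.Bijective Φ := by
    have hinj : Function.Injective Φ.toLinearMap :=
      fun x y hxy => RingHom.injective Φ.toRingHom hxy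
    refine ⟨hinj, ?_⟩
    have := (LinearMap.injective_iff_surjective_of_finrank_eq_finrank (f := Φ.toLinearMap)
      (by simp [finrank_matrix, hXY])).1 hinj
    exact this
  let e : End N (X → N) ≃ₐ[N] End N (Y → N) :=
    (algEquivMatrix'.trans (AlgEquiv.ofBijective Φ hbij)).trans algEquivMatrix'.symm
  obtain ⟨T, hT⟩ := e.eq_linearEquivConjAlgEquiv
  refine ⟨LinearMap.toMatrix' T.toLinearMap, LinearMap.toMatrix' T.symm.toLinearMap, ?_, ?_, ?_⟩
  · rw [← LinearMap.toMatrix'_comp]; simp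
  · rw [← LinearMap.toMatrix'_comp]; simp
  · intro a
    have h := congrArg (fun q => LinearMap.toMatrix' (q (algEquivMatrix'.symm (f a)))) hT
    have h1 : LinearMap.toMatrix' (e (algEquivMatrix'.symm (f a))) = g a := by
      rw [← hφ]
      simp only [e, AlgEquiv.trans_apply, AlgEquiv.apply_symm_apply]
      exact LinearMap.toMatrix'_toLin' _
    simp only [h1] at h
    rw [h, LinearEquiv.conjAlgEquiv_apply, LinearMap.toMatrix'_comp, LinearMap.toMatrix'_comp,
      Matrix.mul_assoc]
    congr 2
    exact LinearMap.toMatrix'_toLin' _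

lemma exists_scalar_of_commute [Nonempty X] {S : Set (Matrix X X N)}
    (hS : Submodule.span N S = ⊤) {z : Matrix X X N} (hz : ∀ s ∈ S, z * s = s * z) :
    ∃ c : N, z = Matrix.scalar X c := by
  have h : ∀ s, s * z = z * s := by
    intro s
    have hs : s ∈ Submodule.span N S := by rw [hS]; trivial
    induction hs using Submodule.span_induction with
    | mem s hs => exact (hz s hs).symm
    | zero => simp
    | add _ _ _ _ h1 h2 => simp [add_mul, mul_add, h1, h2]
    | smul _ _ _ h => simp [h]
  have : z ∈ Set.range (Matrix.scalar X) :=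
    Matrix.mem_range_scalar_of_commute_single fun i j _ => h (Matrix.single i j 1)
  obtain ⟨c, rfl⟩ := this
  exact ⟨c, rfl⟩

end Conjugation

section CyclicRelations

open Polynomial

lemma mul_aeval_of_mul_eq_sub_one_mul {F R : Type*} [Field F] [Ring R] [Algebra F R] {i j : R}
    (hji : j * i = (i - 1) * j) (q : F[X]) :
    j * aeval i q = aeval (i - 1) q * j := by
  induction q using Polynomial.induction_on' with
  | add q r hq hr => simp [mul_add, add_mul, hq, hr]
  | monomial n a =>
    have h : ∀ n : ℕ, j * i ^ n = (i - 1) ^ n * j := by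
      intro n
      induction n with
      | zero => simp
      | succ n ih => rw [pow_succ, ← mul_assoc, ih, mul_assoc, hji, ← mul_assoc, ← pow_succ]
    simp only [aeval_monomial]
    rw [← mul_assoc, ← Algebra.commutes, mul_assoc, h, mul_assoc]

lemma commutator_pow_of_mul_eq_sub_one_mul {R : Type*} [Ring R] {i j : R}
    (hji : j * i = (i - 1) * j) (l : ℕ) :
    i * j ^ l - j ^ l * i = (l : R) * j ^ l := by
  induction l with
  | zero => simp
  | succ l ih =>
    have h : i * j = j * i + j := by rw [hji]; noncomm_ring
    have h2 : i * j ^ l = (l : R) * j ^ l + j ^ l * i := by rw [← ih]; abel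
    rw [pow_succ, ← mul_assoc, h2, add_mul, mul_assoc _ i j, h]
    push_cast
    noncomm_ring

lemma natCast_fin_injective {p : ℕ} {F : Type*} [Field F] [CharP F p] :
    Function.Injective fun l : Fin p => ((l : ℕ) : F) := by
  intro a b hab
  have := (CharP.natCast_eq_natCast F p).1 hab
  exact Fin.ext (Nat.ModEq.eq_of_lt_of_lt this a.2 b.2)

variable {p : ℕ} (F : Type*) {R : Type*} [Field F] [CharP F p] [Ring R] [Algebra F R] {i j : R}

include F in
lemma eq_zero_of_sum_mul_pow_eq_zero (hj : IsUnit j) (hji : j * i = (i - 1) * j)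
    (b : Fin p → R) (hbi : ∀ k, Commute (b k) i) (hbj : ∀ k, Commute (b k) j)
    (h : ∑ k, b k * i ^ (k : ℕ) = 0) (k : Fin p) : b k = 0 := by
  have hm : ∀ m : ℕ, ∑ k, b k * (i - (m : R)) ^ (k : ℕ) = 0 := by
    intro m
    induction m with
    | zero => simpa using h
    | succ m ih =>
      have h1 : j * ∑ k, b k * (i - (m : R)) ^ (k : ℕ) =
          (∑ k, b k * (i - ((m + 1 : ℕ) : R)) ^ (k : ℕ)) * j := by
        rw [Finset.mul_sum, Finset.sum_mul]
        refine Finset.sum_congr rfl fun k _ => ?_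
        have h2 := mul_aeval_of_mul_eq_sub_one_mul (F := F) hji ((X - C (m : F)) ^ (k : ℕ))
        simp only [map_pow, map_sub, aeval_X, map_natCast] at h2
        rw [← mul_assoc, ← (hbj k).eq, mul_assoc, h2, mul_assoc]
        congr 3
        push_cast
        abel
      rw [ih, mul_zero] at h1
      exact (hj.mul_left_eq_zero).1 h1.symm
  let v : Fin p → F[X] := fun m => C (-((m : ℕ) : F)) + X
  let V := Matrix.vandermonde v
  have hdet : V.det = C (Matrix.vandermonde fun m : Fin p => -((m : ℕ) : F)).det := by
    rw [Matrix.det_vandermonde_add, RingHom.map_det]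
    congr 1
    ext a c : 2
    simp [Matrix.vandermonde]
  have hdet0 : (Matrix.vandermonde fun m : Fin p => -((m : ℕ) : F)).det ≠ 0 := by
    rw [Matrix.det_vandermonde_ne_zero_iff]
    exact fun a c hac => natCast_fin_injective (F := F) (neg_injective hac)
  have hcomm : ∀ (q : F[X]) k, Commute (b k) (aeval i q) := by
    intro q k
    rw [aeval_eq_sum_range]
    exact Commute.sum_right _ _ _ fun n _ => ((hbi k).pow_right n).smul_right _
  have key : ∑ m, aeval i (V.adjugate k m) * ∑ l, b l * aeval i (V m l) = 0 := by
    refine Finset.sum_eq_zero fun m _ => ?_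
    have := hm m
    have h3 : ∑ l, b l * aeval i (V m l) = 0 := by
      rw [← this]
      refine Finset.sum_congr rfl fun l _ => ?_
      simp only [V, v, Matrix.vandermonde_apply, map_pow, map_add, aeval_X, map_neg,
        map_natCast]
      congr 2
      abel
    rw [h3, mul_zero]
  have key2 : ∑ m, aeval i (V.adjugate k m) * ∑ l, b l * aeval i (V m l) =
      ∑ l, b l * aeval i ((V.adjugate * V) k l) := by
    simp only [Finset.mul_sum, Matrix.mul_apply, map_sum]
    rw [Finset.sum_comm]
    refine Finset.sum_congr rfl fun l _ => Finset.sum_congr rfl fun m _ => ?_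
    rw [map_mul, ← mul_assoc, ← (hcomm _ l).eq, mul_assoc]
  rw [key, Matrix.adjugate_mul, hdet] at key2
  simp only [Matrix.smul_apply, Matrix.one_apply, smul_eq_mul, mul_ite, mul_one, mul_zero] at key2
  rw [Finset.sum_eq_single k (by intro l _ hl; simp [hl.symm]) (by simp)] at key2
  simp only [if_true, aeval_C] at key2
  have hu := (IsUnit.mk0 _ hdet0).map (algebraMap F R)
  exact (hu.mul_left_eq_zero).1 key2.symm

include F in
/-- Over the centralizer of `i` and `j`, the monomials `i ^ k * j ^ l` are linearly independent. -/
lemma eq_zero_of_sum_mul_pow_mul_pow_eq_zero (hj : IsUnit j) (hji : j * i = (i - 1) * j)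
    (b : Fin p → Fin p → R) (hbi : ∀ k l, Commute (b k l) i) (hbj : ∀ k l, Commute (b k l) j)
    (h : ∑ l, ∑ k, b k l * i ^ (k : ℕ) * j ^ (l : ℕ) = 0) (k l : Fin p) : b k l = 0 := by
  let ad : End F R := LinearMap.mulLeft F i - LinearMap.mulRight F i
  let y : Fin p → R := fun l => ∑ k, b k l * i ^ (k : ℕ) * j ^ (l : ℕ)
  have hy : ∀ l : Fin p, y l ∈ ad.eigenspace ((l : ℕ) : F) := by
    intro l
    rw [Module.End.mem_eigenspace_iff]
    simp only [ad, LinearMap.sub_apply, LinearMap.mulLeft_apply, LinearMap.mulRight_apply, y,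
      Finset.mul_sum, Finset.sum_mul, ← Finset.sum_sub_distrib, Finset.smul_sum]
    refine Finset.sum_congr rfl fun k _ => ?_
    have h1 : Commute (b k l * i ^ (k : ℕ)) i := (hbi k l).mul_left (Commute.pow_self i k)
    rw [← mul_assoc, ← h1.eq, mul_assoc _ i, mul_assoc _ (j ^ (l : ℕ)) i, ← mul_sub,
      commutator_pow_of_mul_eq_sub_one_mul hji, Algebra.smul_def, map_natCast, ← mul_assoc,
      ← mul_assoc, (Nat.cast_commute (l : ℕ) (b k l * i ^ (k : ℕ))).eq]
  have hind := (ad.eigenspaces_iSupIndep).comp (natCast_fin_injective (p := p) (F := F))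
  have hy0 := (iSupIndep_iff_finsetSum_eq_zero_imp_eq_zero _).1 hind Finset.univ y
    (fun l _ => hy l) h l (Finset.mem_univ l)
  have h2 : (∑ k, b k l * i ^ (k : ℕ)) * j ^ (l : ℕ) = 0 := by
    rw [Finset.sum_mul]; exact hy0
  have h3 := ((hj.pow (l : ℕ)).mul_left_eq_zero).1 h2
  exact eq_zero_of_sum_mul_pow_eq_zero (F := F) hj hji (fun k => b k l) (fun k => hbi k l)
    (fun k => hbj k l) h3 k

end CyclicRelations

section CyclicAlgebras

open Polynomial

variable {p : ℕ} {F : Type} [Field F]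

lemma isUnit_of_pow_eq_algebraMap {R : Type*} [Ring R] [Algebra F R] (hp : p.Prime) {j : R} {b : F}
    (hb : b ≠ 0) (hj : j ^ p = algebraMap F R b) : IsUnit j := by
  have h : IsUnit (j ^ p) := hj ▸ (IsUnit.mk0 b hb).map _
  exact (isUnit_pow_iff hp.ne_zero).1 h

lemma linearIndependent_pow_mul_pow [CharP F p] {R : Type*} [Ring R] [Algebra F R] [Nontrivial R]
    {i j : R} (hj : IsUnit j) (hji : j * i = (i - 1) * j) :
    LinearIndependent F fun x : Fin p × Fin p => i ^ (x.1 : ℕ) * j ^ (x.2 : ℕ) := by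
  rw [Fintype.linearIndependent_iff]
  rintro g hg ⟨k, l⟩
  have := eq_zero_of_sum_mul_pow_mul_pow_eq_zero (p := p) F hj hji
    (fun k l => algebraMap F R (g (k, l))) (fun k l => Algebra.commutes _ _)
    (fun k l => Algebra.commutes _ _) (by
      rw [← hg, Fintype.sum_prod_type_right]
      simp [Algebra.smul_def, mul_assoc]) k l
  exact (map_eq_zero_iff _ (algebraMap F R).injective).1 this

lemma aeval_mul_pow_mem_span {R : Type*} [Ring R] [Algebra F R] (hp : p.Prime)
    {i j : R} {a b : F} (hi : i ^ p - i = algebraMap F R a) (hj : j ^ p = algebraMap F R b)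
    (q : F[X]) (l : ℕ) : aeval i q * j ^ l ∈
      Submodule.span F (Set.range fun x : Fin p × Fin p => i ^ (x.1 : ℕ) * j ^ (x.2 : ℕ)) := by
  have hd : (X + C a : F[X]).degree < p := by
    rw [degree_X_add_C]
    exact_mod_cast hp.one_lt
  have hm : (X ^ p - (X + C a) : F[X]).Monic := monic_X_pow_sub hd
  have hm0 : aeval i (X ^ p - (X + C a) : F[X]) = 0 := by
    simp [← hi]
  have hq : aeval i q = aeval i (q %ₘ (X ^ p - (X + C a) : F[X])) := by
    conv_lhs => rw [← modByMonic_add_div q (X ^ p - (X + C a) : F[X])]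
    rw [map_add, map_mul, hm0, zero_mul, add_zero]
  have hdeg : (q %ₘ (X ^ p - (X + C a) : F[X])).degree < p := by
    refine (degree_modByMonic_lt q hm).trans_eq ?_
    rw [degree_sub_eq_left_of_degree_lt (by rwa [degree_X_pow]), degree_X_pow]
  have hl : j ^ l = algebraMap F R (b ^ (l / p)) * j ^ (l % p) := by
    conv_lhs => rw [← Nat.div_add_mod l p]
    rw [pow_add, pow_mul, hj, map_pow]
  rw [hq, hl, ← mul_assoc, ← Algebra.commutes, mul_assoc, ← Algebra.smul_def]
  refine Submodule.smul_mem _ _ ?_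
  rw [aeval_eq_sum_range' (n := p), Finset.sum_mul]
  · refine Submodule.sum_mem _ fun k hk => ?_
    rw [smul_mul_assoc]
    exact Submodule.smul_mem _ _ (Submodule.subset_span
      ⟨(⟨k, Finset.mem_range.1 hk⟩, ⟨l % p, Nat.mod_lt _ hp.pos⟩), rfl⟩)
  · by_cases h0 : q %ₘ (X ^ p - (X + C a) : F[X]) = 0
    · rw [h0, natDegree_zero]; exact hp.pos
    · exact (natDegree_lt_iff_degree_lt h0).2 hdeg

lemma span_pow_mul_pow_eq_adjoin {R : Type*} [Ring R] [Algebra F R] (hp : p.Prime)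
    {i j : R} {a b : F} (hi : i ^ p - i = algebraMap F R a) (hj : j ^ p = algebraMap F R b)
    (hji : j * i = (i - 1) * j) :
    Submodule.span F (Set.range fun x : Fin p × Fin p => i ^ (x.1 : ℕ) * j ^ (x.2 : ℕ)) =
      Subalgebra.toSubmodule (Algebra.adjoin F {i, j}) := by
  have hij : i ∈ Algebra.adjoin F {i, j} ∧ j ∈ Algebra.adjoin F {i, j} :=
    ⟨Algebra.subset_adjoin (by simp), Algebra.subset_adjoin (by simp)⟩
  have hmem := aeval_mul_pow_mem_span hp hi hj
  set S := Submodule.span F (Set.range fun x : Fin p × Fin p => i ^ (x.1 : ℕ) * j ^ (x.2 : ℕ))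
    with hS
  apply le_antisymm
  · rw [Submodule.span_le]
    rintro _ ⟨x, rfl⟩
    show _ ∈ Algebra.adjoin F {i, j}
    exact mul_mem (pow_mem hij.1 _) (pow_mem hij.2 _)
  · have hi' : ∀ s ∈ S, i * s ∈ S := by
      intro s hs
      induction hs using Submodule.span_induction with
      | mem s hs =>
        obtain ⟨x, rfl⟩ := hs
        have := hmem (X ^ ((x.1 : ℕ) + 1)) x.2
        rw [map_pow, aeval_X, pow_succ', mul_assoc] at this
        exact this
      | zero => simp
      | add _ _ _ _ h1 h2 => rw [mul_add]; exact add_mem h1 h2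
      | smul c _ _ h => rw [mul_smul_comm]; exact Submodule.smul_mem _ _ h
    have hj' : ∀ s ∈ S, j * s ∈ S := by
      intro s hs
      induction hs using Submodule.span_induction with
      | mem s hs =>
        obtain ⟨x, rfl⟩ := hs
        have h := mul_aeval_of_mul_eq_sub_one_mul (F := F) hji (X ^ (x.1 : ℕ))
        have := hmem ((X - 1) ^ (x.1 : ℕ)) ((x.2 : ℕ) + 1)
        simp only [map_pow, aeval_X, map_sub, map_one] at this h
        rw [pow_succ', ← mul_assoc, ← h, mul_assoc] at this
        exact this
      | zero => simp
      | add _ _ _ _ h1 h2 => rw [mul_add]; exact add_mem h1 h2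
      | smul c _ _ h => rw [mul_smul_comm]; exact Submodule.smul_mem _ _ h
    have hall : ∀ r ∈ Algebra.adjoin F {i, j}, ∀ s ∈ S, r * s ∈ S := by
      intro r hr
      induction hr using Algebra.adjoin_induction with
      | mem r hr =>
        rcases hr with rfl | rfl
        · exact hi'
        · exact hj'
      | algebraMap c => intro s hs; rw [← Algebra.smul_def]; exact Submodule.smul_mem _ _ hs
      | add _ _ _ _ h1 h2 => intro s hs; rw [add_mul]; exact add_mem (h1 s hs) (h2 s hs)
      | mul _ _ _ _ h1 h2 => intro s hs; rw [mul_assoc]; exact h1 _ (h2 s hs)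
    intro r hr
    have h1 : (1 : R) ∈ S := by simpa using hmem 1 0
    simpa using hall r hr 1 h1

lemma isCyclicAlgWith_adjoin [CharP F p] {R : Type} [Ring R] [Algebra F R] [Nontrivial R]
    (hp : p.Prime) {i j : R} {a b : F} (hb : b ≠ 0) (hi : i ^ p - i = algebraMap F R a)
    (hj : j ^ p = algebraMap F R b) (hji : j * i = (i - 1) * j) :
    IsCyclicAlgWith p F (Algebra.adjoin F {i, j}) a b := by
  have hij : i ∈ Algebra.adjoin F {i, j} ∧ j ∈ Algebra.adjoin F {i, j} :=
    ⟨Algebra.subset_adjoin (by simp), Algebra.subset_adjoin (by simp)⟩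
  refine ⟨hb, ?_, ⟨i, hij.1⟩, ⟨j, hij.2⟩, Subtype.ext hi, Subtype.ext hj, Subtype.ext hji, ?_⟩
  · have h := span_pow_mul_pow_eq_adjoin hp hi hj hji
    have h2 := finrank_span_eq_card
      (linearIndependent_pow_mul_pow (F := F) (isUnit_of_pow_eq_algebraMap hp hb hj) hji)
    rw [h] at h2
    rw [← Subalgebra.finrank_toSubmodule, h2]
    simp [sq]
  · have := Algebra.adjoin_adjoin_coe_preimage (R := F) (s := {i, j})
    rw [← this]
    congr 1
    ext x
    simp [Subtype.ext_iff]

lemma IsCyclicAlgWith.nontrivial {C : Type} [Ring C] [Algebra F C] (hp : p.Prime) {a b : F}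
    (h : IsCyclicAlgWith p F C a b) : Nontrivial C := by
  have : 0 < finrank F C := by rw [h.2.1]; exact pow_pos hp.pos 2
  exact Module.nontrivial_of_finrank_pos this

lemma IsCyclicAlgWith.mulOpposite {C : Type} [Ring C] [Algebra F C] (hp : p.Prime) [CharP F p]
    {a b : F} (h : IsCyclicAlgWith p F C a b) : IsCyclicAlgWith p F Cᵐᵒᵖ (-a) b := by
  have hnt := h.nontrivial hp
  obtain ⟨hb, hd, i, j, hi, hj, hji, hgen⟩ := h
  have : Fact p.Prime := ⟨hp⟩
  have : CharP C p := charP_of_injective_algebraMap (algebraMap F C).injective p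
  have hneg : (-i) ^ p = -i ^ p := by
    rw [neg_pow, neg_one_pow_char, neg_one_mul]
  have hi' : (MulOpposite.op (-i)) ^ p - MulOpposite.op (-i) = algebraMap F Cᵐᵒᵖ (-a) := by
    rw [← MulOpposite.op_pow, ← MulOpposite.op_sub, MulOpposite.algebraMap_apply, map_neg, ← hi,
      hneg]
    congr 1
    abel
  have hj' : (MulOpposite.op j) ^ p = algebraMap F Cᵐᵒᵖ b := by
    rw [← MulOpposite.op_pow, hj, MulOpposite.algebraMap_apply]
  have hji' : MulOpposite.op j * MulOpposite.op (-i) =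
      (MulOpposite.op (-i) - 1) * MulOpposite.op j := by
    rw [← MulOpposite.op_one, ← MulOpposite.op_sub, ← MulOpposite.op_mul, ← MulOpposite.op_mul]
    congr 1
    rw [neg_mul, mul_sub, mul_neg, hji]
    noncomm_ring
  have hd' : finrank F Cᵐᵒᵖ = p ^ 2 := by
    rw [← hd]
    exact (MulOpposite.opLinearEquiv F).symm.finrank_eq
  refine ⟨hb, hd', MulOpposite.op (-i), MulOpposite.op j, hi', hj', hji', ?_⟩
  have h2 := (isCyclicAlgWith_adjoin hp hb hi' hj' hji').2.1
  have hfin : FiniteDimensional F Cᵐᵒᵖ :=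
    FiniteDimensional.of_finrank_pos (by rw [hd']; exact pow_pos hp.pos 2)
  rw [← hd', ← Subalgebra.finrank_toSubmodule] at h2
  have := Submodule.eq_top_of_finrank_eq h2
  exact Algebra.toSubmodule_eq_top.1 this

/-- The enveloping algebra of a cyclic algebra is split. -/
lemma IsCyclicAlgWith.nonempty_tensor_mulOpposite_algEquiv {C : Type} [Ring C] [Algebra F C]
    (hp : p.Prime) [CharP F p] {a b : F} (h : IsCyclicAlgWith p F C a b) :
    Nonempty (C ⊗[F] Cᵐᵒᵖ ≃ₐ[F] Matrix (Fin (p ^ 2)) (Fin (p ^ 2)) F) := by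
  have hnt := h.nontrivial hp
  obtain ⟨hb, hd, i, j, hi, hj, hji, hgen⟩ := h
  have hju := isUnit_of_pow_eq_algebraMap hp hb hj
  have hfin : FiniteDimensional F C :=
    FiniteDimensional.of_finrank_pos (by rw [hd]; exact pow_pos hp.pos 2)
  have hne : Nonempty (Fin p × Fin p) := ⟨(⟨0, hp.pos⟩, ⟨0, hp.pos⟩)⟩
  let B : Basis (Fin p × Fin p) F C := basisOfLinearIndependentOfCardEqFinrank
    (linearIndependent_pow_mul_pow (F := F) hju hji) (by rw [hd]; simp [sq])
  have hB : ∀ x, B x = i ^ (x.1 : ℕ) * j ^ (x.2 : ℕ) := fun x => by simp [B]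
  let φ := AlgHom.mulLeftRight F C
  have hinj : Function.Injective φ := by
    rw [injective_iff_map_eq_zero]
    intro t ht
    obtain ⟨c, hc⟩ := TensorProduct.eq_repr_basis_left B t
    have hc' : ∑ x : Fin p × Fin p, B x ⊗ₜ[F] c x = t := by
      rw [← hc, Finsupp.sum_fintype _ _ (by simp)]
    let r : Cᵐᵒᵖ → End F C := fun y => LinearMap.mulRight F y.unop
    have h0 : ∑ l : Fin p, ∑ k : Fin p, r (c (k, l)) *
        (LinearMap.mulLeft F i) ^ (k : ℕ) * (LinearMap.mulLeft F j) ^ (l : ℕ) = 0 := by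
      rw [← ht, ← hc', map_sum, Fintype.sum_prod_type_right]
      refine Finset.sum_congr rfl fun l _ => Finset.sum_congr rfl fun k _ => ?_
      ext y
      simp [r, φ, AlgHom.mulLeftRight_apply, hB, LinearMap.pow_mulLeft, mul_assoc]
    have h1 : ∀ k l, r (c (k, l)) = 0 := by
      refine eq_zero_of_sum_mul_pow_mul_pow_eq_zero (p := p) F ?_ ?_ (fun k l => r (c (k, l)))
        ?_ ?_ h0
      · exact hju.map (Algebra.lmul F C)
      · ext y
        simp [← mul_assoc, hji]
        noncomm_ring
      · intro k l
        ext y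
        simp [r, mul_assoc]
      · intro k l
        ext y
        simp [r, mul_assoc]
    rw [← hc']
    refine Finset.sum_eq_zero fun x _ => ?_
    have h2 := LinearMap.congr_fun (h1 x.1 x.2) 1
    simp only [r, LinearMap.mulRight_apply, one_mul, LinearMap.zero_apply] at h2
    rw [show c x = 0 from MulOpposite.unop_injective h2, TensorProduct.tmul_zero]
  have hfd : finrank F (C ⊗[F] Cᵐᵒᵖ) = finrank F (End F C) := by
    rw [finrank_tensorProduct, finrank_linearMap, ← (MulOpposite.opLinearEquiv F).finrank_eq]
  have hbij : Function.Bijective φ := ⟨hinj,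
    (LinearMap.injective_iff_surjective_of_finrank_eq_finrank (f := φ.toLinearMap) hfd).1 hinj⟩
  exact ⟨(AlgEquiv.ofBijective φ hbij).trans
    (algEquivMatrix ((finBasis F C).reindex (finCongr hd)))⟩

end CyclicAlgebras

section SymbolLength

lemma nonempty_piTensorProduct_succ_algEquiv {F : Type*} [Field F] {k : ℕ} (D : Fin (k + 1) → Type*)
    [∀ i, Ring (D i)] [∀ i, Algebra F (D i)] :
    Nonempty ((⨂[F] i, D i) ≃ₐ[F] D 0 ⊗[F] (⨂[F] i : Fin k, D i.succ)) := by
  let c : D 0 →ₗ[F] MultilinearMap F (fun i : Fin k => D i.succ)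
      (D 0 ⊗[F] (⨂[F] i : Fin k, D i.succ)) :=
    { toFun := fun x => (TensorProduct.mk F (D 0) (⨂[F] i : Fin k, D i.succ) x).compMultilinearMap
        (PiTensorProduct.tprod F)
      map_add' := fun x y => by ext; simp
      map_smul' := fun r x => by ext; simp [TensorProduct.smul_tmul'] }
  let f : (⨂[F] i, D i) →ₐ[F] D 0 ⊗[F] (⨂[F] i : Fin k, D i.succ) :=
    PiTensorProduct.liftAlgHom c.uncurryLeft rfl (by
      intro x y
      simp only [LinearMap.uncurryLeft_apply, c, LinearMap.coe_mk, AddHom.coe_mk,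
        LinearMap.compMultilinearMap_apply, TensorProduct.mk_apply,
        Algebra.TensorProduct.tmul_mul_tmul, PiTensorProduct.tprod_mul_tprod]
      rfl)
  have hf : ∀ x, f (PiTensorProduct.tprod F x) =
      x 0 ⊗ₜ[F] PiTensorProduct.tprod F (Fin.tail x) := fun x =>
    PiTensorProduct.lift.tprod x
  let g : D 0 ⊗[F] (⨂[F] i : Fin k, D i.succ) →ₗ[F] ⨂[F] i, D i :=
    TensorProduct.lift (PiTensorProduct.lift.toLinearMap ∘ₗ
      (PiTensorProduct.tprod F (s := D)).curryLeft)
  have hg : ∀ x y, g (x ⊗ₜ[F] PiTensorProduct.tprod F y) =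
      PiTensorProduct.tprod F (Fin.cons x y : ∀ i, D i) := fun x y => by
    simp [g]
  refine ⟨AlgEquiv.ofBijective f ⟨Function.LeftInverse.injective (g := g) fun x => ?_,
    Function.RightInverse.surjective (g := g) fun x => ?_⟩⟩
  · induction x using PiTensorProduct.induction_on with
    | smul_tprod r x =>
      rw [map_smul, map_smul, hf, hg, Fin.cons_self_tail]
    | add x y hx hy => rw [map_add, map_add, hx, hy]
  · induction x using TensorProduct.induction_on with
    | zero => simp
    | add x y hx hy => rw [map_add, map_add, hx, hy]
    | tmul x y =>
      induction y using PiTensorProduct.induction_on with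
      | smul_tprod r y =>
        rw [TensorProduct.tmul_smul, map_smul, map_smul, hg, hf, Fin.tail_cons, Fin.cons_zero]
      | add y z hy hz => rw [TensorProduct.tmul_add, map_add, map_add, hy, hz]

lemma nonempty_matrix_tensor_algEquiv {F : Type*} [Field F] (n : ℕ) (A B : Type*) [Ring A]
    [Algebra F A] [Ring B] [Algebra F B] :
    Nonempty (Matrix (Fin n) (Fin n) A ⊗[F] B ≃ₐ[F] Matrix (Fin n) (Fin n) (A ⊗[F] B)) :=
  ⟨(Algebra.TensorProduct.congr (matrixEquivTensor (Fin n) F A) AlgEquiv.refl).trans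
    (((Algebra.TensorProduct.assoc F F F A (Matrix (Fin n) (Fin n) F) B).trans
      ((Algebra.TensorProduct.congr AlgEquiv.refl (Algebra.TensorProduct.comm F _ B)).trans
        (Algebra.TensorProduct.assoc F F F A B (Matrix (Fin n) (Fin n) F)).symm)).trans
      (matrixEquivTensor (Fin n) F (A ⊗[F] B)).symm)⟩

lemma nonempty_tensor_matrix_algEquiv {F : Type*} [Field F] (n m : ℕ) (A B : Type*) [Ring A]
    [Algebra F A] [Ring B] [Algebra F B] (e : B ≃ₐ[F] Matrix (Fin m) (Fin m) F) :
    Nonempty (Matrix (Fin n) (Fin n) (A ⊗[F] B) ≃ₐ[F]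
      Matrix (Fin (n * m)) (Fin (n * m)) A) :=
  ⟨((Algebra.TensorProduct.congr AlgEquiv.refl e).trans
      (matrixEquivTensor (Fin m) F A).symm).mapMatrix.trans
    ((Matrix.compAlgEquiv (Fin n) (Fin m) A F).trans
      (Matrix.reindexAlgEquiv F A finProdFinEquiv))⟩

variable {p : ℕ} {F : Type} [Field F]

/-- Removing one cyclic tensor factor increases the symbol length by at most one. -/
lemma SymbolLengthLE.of_tensor [CharP F p] (hp : p.Prime) {A C : Type} [Ring A] [Algebra F A]
    [Ring C] [Algebra F C] (hC : IsCyclicPAlg p F C) {m : ℕ}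
    (h : SymbolLengthLE p F (A ⊗[F] C) m) : SymbolLengthLE p F A (m + 1) := by
  obtain ⟨a, b, hC⟩ := hC
  obtain ⟨e⟩ := hC.nonempty_tensor_mulOpposite_algEquiv hp
  obtain ⟨k, hk, D, iR, iA, hD, n, r, hn, hr, ⟨φ⟩⟩ := h
  let iR₀ : Ring Cᵐᵒᵖ := inferInstance
  let iA₀ : Algebra F Cᵐᵒᵖ := inferInstance
  let D' : Fin (k + 1) → Type := Fin.cons (α := fun _ => Type) Cᵐᵒᵖ D
  let iR' : ∀ i, Ring (D' i) := Fin.cases iR₀ iR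
  let iA' : ∀ i, Algebra F (D' i) := Fin.cases iA₀ iA
  refine ⟨k + 1, by omega, D', iR', iA', ?_, n * p ^ 2, r, Nat.mul_pos hn (pow_pos hp.pos 2),
    hr, ?_⟩
  · intro i
    induction i using Fin.cases with
    | zero => exact ⟨-a, b, hC.mulOpposite hp⟩
    | succ i => exact hD i
  · obtain ⟨ψ⟩ := nonempty_piTensorProduct_succ_algEquiv (F := F) D'
    have ψ' : (⨂[F] i, D' i) ≃ₐ[F] Cᵐᵒᵖ ⊗[F] (⨂[F] i, D i) := ψ
    obtain ⟨e1⟩ := nonempty_matrix_tensor_algEquiv (F := F) r (⨂[F] i, D i) Cᵐᵒᵖ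
    obtain ⟨e2⟩ := nonempty_matrix_tensor_algEquiv (F := F) n (A ⊗[F] C) Cᵐᵒᵖ
    obtain ⟨e3⟩ := nonempty_tensor_matrix_algEquiv (F := F) n (p ^ 2) A (C ⊗[F] Cᵐᵒᵖ) e
    let e4 := (ψ'.trans (Algebra.TensorProduct.comm F Cᵐᵒᵖ (⨂[F] i, D i))).mapMatrix
      (m := Fin r)
    let e5 := (Algebra.TensorProduct.assoc F F F A C Cᵐᵒᵖ).mapMatrix (m := Fin n)
    exact ⟨e3.symm.trans (e5.symm.trans (e2.symm.trans
      ((Algebra.TensorProduct.congr φ AlgEquiv.refl).trans (e1.trans e4.symm))))⟩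

lemma symbolLengthLE_of_algEquiv_matrix {A : Type} [Ring A] [Algebra F A] {d : ℕ} (hd : 0 < d)
    (e : A ≃ₐ[F] Matrix (Fin d) (Fin d) F) (m : ℕ) : SymbolLengthLE p F A m := by
  refine ⟨0, m.zero_le, fun _ => F, inferInstance, inferInstance, fun i => i.elim0, 1, d, one_pos,
    hd, ⟨?_⟩⟩
  exact e.mapMatrix.trans ((Matrix.compAlgEquiv (Fin 1) (Fin d) F F).trans
    ((Matrix.reindexAlgEquiv F F (Equiv.uniqueProd (Fin d) (Fin 1))).trans
      (PiTensorProduct.constantBaseRingEquiv (Fin 0) F).symm.mapMatrix))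

end SymbolLength

section Descent

lemma exists_derivation_of_pow_basis {p : ℕ} {K N : Type*} [Field K] [Field N] [Algebra K N]
    [CharP K p] (hp : p.Prime) {x : N} {c : K} (hc : x ^ p = algebraMap K N c)
    (B : Basis (Fin p) K N) (hB : ∀ k, B k = x ^ (k : ℕ)) :
    ∃ δ : N →ₗ[K] N, (∀ m n, δ (m * n) = m * δ n + δ m * n) ∧ δ x = x := by
  let δ : N →ₗ[K] N := B.constr K fun k => ((k : ℕ) : N) * x ^ (k : ℕ)
  have hchar : CharP N p := charP_of_injective_algebraMap (algebraMap K N).injective p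
  have hδB : ∀ k, δ (B k) = ((k : ℕ) : N) * x ^ (k : ℕ) := B.constr_basis K _
  have hδ : ∀ n : ℕ, δ (x ^ n) = (n : N) * x ^ n := by
    intro n
    have h1 : x ^ n = c ^ (n / p) • x ^ (n % p) := by
      conv_lhs => rw [← Nat.div_add_mod n p]
      rw [pow_add, pow_mul, hc, Algebra.smul_def, map_pow]
    have h2 := hδB ⟨n % p, Nat.mod_lt _ hp.pos⟩
    rw [hB] at h2
    have h3 : ((n % p : ℕ) : N) = n := (CharP.natCast_eq_natCast N p).2 (Nat.mod_modEq n p)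
    rw [h1, map_smul, h2, h3, mul_smul_comm]
  refine ⟨δ, fun m n => ?_, by simpa using hδ 1⟩
  have key : (LinearMap.mul K N).compr₂ δ =
      (LinearMap.mul K N).compl₂ δ + (LinearMap.mul K N) ∘ₗ δ := by
    refine B.ext fun k => B.ext fun l => ?_
    simp only [LinearMap.compr₂_apply, LinearMap.mul_apply', LinearMap.add_apply,
      LinearMap.compl₂_apply, LinearMap.comp_apply]
    rw [hδB, hδB, hB, hB, ← pow_add, hδ]
    push_cast
    ring
  exact LinearMap.congr_fun₂ key m n

variable {F K N A : Type*} [Field F] [Field K] [Field N] [Algebra F K] [Algebra K N] [Algebra F N]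
  [IsScalarTower F K N] [Ring A] [Algebra F A]

/-- A derivation of the splitting field lifts to the standard module of a split algebra. -/
lemma exists_lift_derivation {d : ℕ} (hd : 0 < d) (f : A →ₐ[F] Matrix (Fin d) (Fin d) N)
    (hf : Submodule.span N (Set.range f) = ⊤) (hA : finrank F A = d ^ 2) (δ : N →ₗ[K] N)
    (hδ : ∀ m n, δ (m * n) = m * δ n + δ m * n) :
    ∃ D : (Fin d → N) →ₗ[K] (Fin d → N), (∀ n v, D (n • v) = n • D v + δ n • v) ∧
      ∀ a v, D ((f a).mulVec v) = (f a).mulVec (D v) := by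
  have : FiniteDimensional F A := FiniteDimensional.of_finrank_pos (by rw [hA]; positivity)
  let b := finBasis F A
  obtain ⟨hli, hspan⟩ := linearIndependent_comp_basis_of_span_range_eq_top b f hf
    (by simpa using hA)
  let B : Basis _ N (Matrix (Fin d) (Fin d) N) := Basis.mk hli hspan
  have hBb : ∀ i, B i = f (b i) := fun i => by simp [B]
  let Δ : Matrix (Fin d) (Fin d) N →ₗ[K] Matrix (Fin d) (Fin d) N :=
    { toFun := fun M => ∑ i, δ (B.repr M i) • B i
      map_add' := fun x y => by simp [add_smul, Finset.sum_add_distrib]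
      map_smul' := fun r x => by
        have : ∀ i, B.repr (r • x) i = r • B.repr x i := fun i => by
          rw [← algebraMap_smul N r x, map_smul, Finsupp.smul_apply, algebraMap_smul]
        simp [this, Finset.smul_sum] }
  have hδF : ∀ (r : F) n, δ (r • n) = r • δ n := fun r n => by
    rw [← algebraMap_smul K r n, map_smul, algebraMap_smul]
  have hΔf : ∀ n a, Δ (n • f a) = δ n • f a := by
    intro n a
    have h2 : f a = ∑ i, algebraMap F N (b.repr a i) • B i := by
      conv_lhs => rw [← b.sum_repr a, map_sum]
      refine Finset.sum_congr rfl fun i _ => ?_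
      rw [map_smul, hBb, algebraMap_smul]
    have h1 : ∀ i, B.repr (f a) i = algebraMap F N (b.repr a i) := fun i => by
      rw [h2, B.repr_sum_self]
    show ∑ i, δ (B.repr (n • f a) i) • B i = _
    conv_rhs => rw [h2]
    rw [Finset.smul_sum]
    refine Finset.sum_congr rfl fun i _ => ?_
    rw [map_smul, Finsupp.smul_apply, h1, smul_smul, smul_eq_mul, mul_comm n, ← Algebra.smul_def,
      hδF, Algebra.smul_def (b.repr a i) (δ n), mul_comm]
  have hind : ∀ (P : Matrix (Fin d) (Fin d) N → Prop), (∀ (n : N) a, P (n • f a)) →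
      (∀ x y, P x → P y → P (x + y)) → ∀ M, P M := by
    intro P h1 h2 M
    rw [← B.sum_repr M]
    have h0 : P 0 := by simpa using h1 0 0
    exact Finset.sum_induction _ P h2 h0 fun i _ => by rw [hBb]; exact h1 _ _
  have hΔsmul : ∀ n M, Δ (n • M) = n • Δ M + δ n • M := by
    intro n
    refine hind _ (fun m a => ?_) fun x y hx hy => ?_
    · rw [smul_smul, hΔf, hΔf, hδ, add_smul, smul_smul, smul_smul]
    · rw [smul_add, map_add, hx, hy, map_add, smul_add, smul_add]; abel
  have hΔmul : ∀ a M, Δ (f a * M) = f a * Δ M := by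
    intro a
    refine hind _ (fun m a' => ?_) fun x y hx hy => ?_
    · rw [mul_smul_comm, ← map_mul, hΔf, hΔf, map_mul, mul_smul_comm]
    · rw [mul_add, map_add, hx, hy, map_add, mul_add]
  let e : Fin d → N := Pi.single ⟨0, hd⟩ 1
  let D : (Fin d → N) →ₗ[K] (Fin d → N) :=
    { toFun := fun v => (Δ (Matrix.vecMulVec v e)).mulVec e
      map_add' := fun v w => by
        rw [Matrix.add_vecMulVec, map_add, Matrix.add_mulVec]
      map_smul' := fun r v => by
        rw [Matrix.smul_vecMulVec, map_smul, Matrix.smul_mulVec, RingHom.id_apply] }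
  have hD : ∀ v, D v = (Δ (Matrix.vecMulVec v e)).mulVec e := fun _ => rfl
  refine ⟨D, fun n v => ?_, fun a v => ?_⟩
  · rw [hD, hD, Matrix.smul_vecMulVec, hΔsmul, Matrix.add_mulVec, Matrix.smul_mulVec,
      Matrix.smul_mulVec]
    congr 2
    ext i
    simp [Matrix.mulVec, Matrix.vecMulVec, dotProduct, e, Pi.single_apply]
  · rw [hD, hD, ← Matrix.mul_vecMulVec, hΔmul, Matrix.mulVec_mulVec]

end Descent

section CyclicDescent

lemma pow_sub_self_commute {p : ℕ} (hp : p.Prime) {R : Type*} [Ring R] [CharP R p] {i j : R}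
    (hji : j * i = (i - 1) * j) : Commute (i ^ p - i) j := by
  have : Fact p.Prime := ⟨hp⟩
  have h : ∀ n : ℕ, j * i ^ n = (i - 1) ^ n * j := by
    intro n
    induction n with
    | zero => simp
    | succ n ih => rw [pow_succ, ← mul_assoc, ih, mul_assoc, hji, ← mul_assoc, ← pow_succ]
  show _ * _ = _ * _
  rw [mul_sub, h, hji, sub_pow_char_of_commute _ (Commute.one_right i), one_pow]
  noncomm_ring

variable {p : ℕ} {F K N A : Type} [Field F] [Field K] [Field N] [Algebra F K] [Algebra K N]
  [Algebra F N] [IsScalarTower F K N] [Ring A] [Algebra F A] [CharP F p]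

/-- In the endomorphism algebra of the right dimension, the images of an algebra split by `N` and of
a pair of generators with the relations of a cyclic algebra span everything. -/
lemma span_mul_pow_mul_pow_eq_top {d : ℕ} (hp : p.Prime) (hd : 0 < d)
    (f : A →ₐ[F] Matrix (Fin d) (Fin d) N)
    (hf : Submodule.span N (Set.range f) = ⊤) (hA : finrank F A = d ^ 2) (hN : finrank K N = p)
    {D X : End K (Fin d → N)} (hX : IsUnit X) (hXD : X * D = (D - 1) * X)
    (fE : A →ₐ[F] End K (Fin d → N)) (hfE : ∀ a v, fE a v = (f a).mulVec v)
    (hDf : ∀ a, Commute (fE a) D) (hXf : ∀ a, Commute (fE a) X) :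
    Submodule.span K (Set.range fun y : A × ℕ × ℕ => fE y.1 * (D ^ y.2.1 * X ^ y.2.2)) = ⊤ := by
  have : FiniteDimensional F A := FiniteDimensional.of_finrank_pos (by rw [hA]; positivity)
  have : FiniteDimensional K N := FiniteDimensional.of_finrank_pos (by rw [hN]; exact hp.pos)
  let b := finBasis F A
  obtain ⟨hli, -⟩ := linearIndependent_comp_basis_of_span_range_eq_top b f hf (by simpa using hA)
  have hli' : LinearIndependent K (fE ∘ b) := by
    have h1 : LinearIndependent K (f ∘ b) := hli.restrict_scalars (by
      intro x y hxy
      simpa [Algebra.smul_def] using hxy)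
    let τ : Matrix (Fin d) (Fin d) N →ₗ[K] End K (Fin d → N) :=
      { toFun := fun M => (Matrix.mulVecLin M).restrictScalars K
        map_add' := fun M M' => by ext : 1; simp
        map_smul' := fun r M => by ext : 1; simp }
    have hτ : Function.Injective τ := by
      intro M M' h
      refine Matrix.ext_of_mulVec_single fun i => ?_
      exact LinearMap.congr_fun h (Pi.single i 1)
    have h2 : fE ∘ b = τ ∘ (f ∘ b) := by
      funext i
      refine LinearMap.ext fun v => ?_
      simp [hfE, τ]
    rw [h2]
    exact h1.map' τ (LinearMap.ker_eq_bot.2 hτ)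
  have : CharP K p := charP_of_injective_algebraMap (algebraMap F K).injective p
  have hLI : LinearIndependent K fun y : Fin (finrank F A) × Fin p × Fin p =>
      fE (b y.1) * (D ^ (y.2.1 : ℕ) * X ^ (y.2.2 : ℕ)) := by
    rw [Fintype.linearIndependent_iff]
    rintro g hg ⟨i, k, l⟩
    have h := eq_zero_of_sum_mul_pow_mul_pow_eq_zero (p := p) K hX hXD
      (fun k l => ∑ i, g (i, k, l) • fE (b i))
      (fun k l => Commute.sum_left _ _ _ fun i _ => (hDf _).smul_left _)
      (fun k l => Commute.sum_left _ _ _ fun i _ => (hXf _).smul_left _) (by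
        rw [← hg, Fintype.sum_prod_type_right, Fintype.sum_prod_type_right]
        refine Finset.sum_congr rfl fun l _ => Finset.sum_congr rfl fun k _ => ?_
        rw [Finset.sum_mul, Finset.sum_mul]
        refine Finset.sum_congr rfl fun i _ => ?_
        rw [smul_mul_assoc, smul_mul_assoc, mul_assoc]) k l
    exact Fintype.linearIndependent_iff.1 hli' (fun i => g (i, k, l)) h i
  have hne : Nonempty (Fin (finrank F A) × Fin p × Fin p) :=
    ⟨⟨0, by rw [hA]; positivity⟩, ⟨0, hp.pos⟩, ⟨0, hp.pos⟩⟩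
  have hspan := hLI.span_eq_top_of_card_eq_finrank (by
    rw [finrank_linearMap, ← finrank_mul_finrank K N (Fin d → N), hN]
    simp [hA]
    ring)
  rw [eq_top_iff, ← hspan]
  apply Submodule.span_mono
  rintro _ ⟨⟨i, k, l⟩, rfl⟩
  exact ⟨(b i, k, l), rfl⟩

/-- An algebra split by `N = K(x)` with `x ^ p ∈ F` becomes split by `K` after tensoring with a
suitable cyclic algebra. -/
lemma exists_cyclic_tensor_algHom {d : ℕ} (hp : p.Prime) (hd : 0 < d)
    (hK : ∀ y : K, ∃ r : F, y ^ p = algebraMap F K r) {x : N} {c : F} (hx : x ≠ 0)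
    (hc : x ^ p = algebraMap F N c) (B : Basis (Fin p) K N) (hB : ∀ k, B k = x ^ (k : ℕ))
    (f : A →ₐ[F] Matrix (Fin d) (Fin d) N)
    (hf : Submodule.span N (Set.range f) = ⊤) (hA : finrank F A = d ^ 2) :
    ∃ (C : Type) (_ : Ring C) (_ : Algebra F C), IsCyclicPAlg p F C ∧
      finrank F (A ⊗[F] C) = (p * d) ^ 2 ∧
      ∃ g : A ⊗[F] C →ₐ[F] Matrix (Fin (p * d)) (Fin (p * d)) K,
        Submodule.span K (Set.range g) = ⊤ := by
  have : Fact p.Prime := ⟨hp⟩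
  have hN : finrank K N = p := by rw [finrank_eq_card_basis B]; simp
  have : FiniteDimensional K N := FiniteDimensional.of_finrank_pos (by rw [hN]; exact hp.pos)
  have hKp : CharP K p := charP_of_injective_algebraMap (algebraMap F K).injective p
  have hne : Nonempty (Fin d) := ⟨⟨0, hd⟩⟩
  have hEp : CharP (End K (Fin d → N)) p :=
    charP_of_injective_algebraMap (algebraMap K (End K (Fin d → N))).injective p
  obtain ⟨δ, hδ, hδx⟩ := exists_derivation_of_pow_basis hp
    (hc.trans (IsScalarTower.algebraMap_apply F K N c)) B hB
  obtain ⟨D, hD, hDf⟩ := exists_lift_derivation (K := K) hd f hf hA δ hδ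
  let X : End K (Fin d → N) := Algebra.lsmul K K (Fin d → N) x
  let fE : A →ₐ[F] End K (Fin d → N) :=
    { toFun := fun a => (Matrix.mulVecLin (f a)).restrictScalars K
      map_one' := by refine LinearMap.ext fun v => ?_; simp
      map_mul' := fun a b => by refine LinearMap.ext fun v => ?_; simp
      map_zero' := by refine LinearMap.ext fun v => ?_; simp
      map_add' := fun a b => by refine LinearMap.ext fun v => ?_; simp
      commutes' := fun r => by
        refine LinearMap.ext fun v => ?_
        rw [AlgHom.commutes]
        simp [Algebra.algebraMap_eq_smul_one] }
  have hfE : ∀ a v, fE a v = (f a).mulVec v := fun _ _ => rfl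
  have hXD : X * D = (D - 1) * X := by
    refine LinearMap.ext fun v => ?_
    show x • D v = D (x • v) - x • v
    rw [hD, hδx, add_sub_cancel_right]
  have hX : X ^ p = algebraMap F _ c := by
    show (Algebra.lsmul K K (Fin d → N) x) ^ p = _
    rw [← map_pow, hc]
    refine LinearMap.ext fun v => ?_
    show algebraMap F N c • v = c • v
    rw [algebraMap_smul]
  have hc0 : c ≠ 0 := by
    rintro rfl
    rw [map_zero] at hc
    exact hx (pow_eq_zero_iff hp.ne_zero |>.1 hc)
  have hXu : IsUnit X := isUnit_of_pow_eq_algebraMap hp hc0 hX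
  have hcD : ∀ a, Commute (fE a) D := fun a => LinearMap.ext fun v => (hDf a v).symm
  have hcX : ∀ a, Commute (fE a) X := fun a => LinearMap.ext fun v => by
    show (f a).mulVec (x • v) = x • (f a).mulVec v
    rw [Matrix.mulVec_smul]
  have hspan := span_mul_pow_mul_pow_eq_top hp hd f hf hA hN hXu hXD fE hfE hcD hcX
  obtain ⟨z, hz⟩ : ∃ z : K, D ^ p - D = algebraMap K _ z := by
    have hcomm : ∀ T : End K (Fin d → N), Commute (D ^ p - D) T := by
      intro T
      have hT : T ∈ Submodule.span K (Set.range fun y : A × ℕ × ℕ =>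
        fE y.1 * (D ^ y.2.1 * X ^ y.2.2)) := by rw [hspan]; trivial
      induction hT using Submodule.span_induction with
      | mem T hT =>
        obtain ⟨⟨a, k, l⟩, rfl⟩ := hT
        have hD' : Commute (D ^ p - D) D := (Commute.pow_self D p).sub_left (Commute.refl D)
        exact ((((hcD a).pow_right p).sub_right (hcD a)).symm).mul_right
          ((hD'.pow_right k).mul_right ((pow_sub_self_commute hp hXD).pow_right l))
      | zero => exact Commute.zero_right _
      | add _ _ _ _ h1 h2 => exact h1.add_right h2
      | smul c _ _ h => exact h.smul_right c
    have : D ^ p - D ∈ Subalgebra.center K (End K (Fin d → N)) :=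
      Subalgebra.mem_center_iff.2 fun T => (hcomm T).symm
    rw [Algebra.IsCentral.center_eq_bot] at this
    obtain ⟨z, hz⟩ := Algebra.mem_bot.1 this
    exact ⟨z, hz.symm⟩
  obtain ⟨r, hr⟩ := hK z
  let D' : End K (Fin d → N) := D + algebraMap K _ z
  have hzc : ∀ T : End K (Fin d → N), Commute T (algebraMap K _ z) := fun T =>
    (Algebra.commutes z T).symm
  have hXD' : X * D' = (D' - 1) * X := by
    rw [mul_add, hXD, (hzc X).eq, ← add_mul]
    congr 1
    show _ = D + _ - 1
    abel
  have hD'p : D' ^ p - D' = algebraMap F _ r := by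
    rw [add_pow_char_of_commute _ (hzc D), ← map_pow, hr, ← IsScalarTower.algebraMap_apply F K]
    have : D ^ p = D + algebraMap K _ z := by rw [← hz]; abel
    rw [this]
    show D + _ + _ - (D + _) = _
    abel
  have hcD' : ∀ a, Commute (fE a) D' := fun a => (hcD a).add_right (hzc _)
  have hspan' := span_mul_pow_mul_pow_eq_top hp hd f hf hA hN hXu hXD' fE hfE hcD' hcX
  have hC := isCyclicAlgWith_adjoin hp hc0 hD'p hX hXD'
  let C := Algebra.adjoin F {D', X}
  have hcomm : ∀ (a : A) (y : C), Commute (fE a) (y : End K (Fin d → N)) := by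
    rintro a ⟨y, hy⟩
    have hle : Algebra.adjoin F {D', X} ≤ Subalgebra.centralizer F {fE a} := by
      rw [Algebra.adjoin_le_iff]
      rintro y (rfl | rfl)
      · exact Subalgebra.mem_centralizer_iff F |>.2 (by rintro _ rfl; exact hcD' a)
      · exact Subalgebra.mem_centralizer_iff F |>.2 (by rintro _ rfl; exact hcX a)
    exact (Subalgebra.mem_centralizer_iff F).1 (hle hy) _ rfl
  let g₀ : A ⊗[F] C →ₐ[F] End K (Fin d → N) := Algebra.TensorProduct.lift fE C.val hcomm
  have hg₀ : Submodule.span K (Set.range g₀) = ⊤ := by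
    rw [eq_top_iff, ← hspan']
    apply Submodule.span_mono
    rintro _ ⟨⟨a, k, l⟩, rfl⟩
    have h1 : D' ∈ C := Algebra.subset_adjoin (by simp)
    have h2 : X ∈ C := Algebra.subset_adjoin (by simp)
    refine ⟨a ⊗ₜ[F] (⟨D', h1⟩ ^ k * ⟨X, h2⟩ ^ l), ?_⟩
    exact Algebra.TensorProduct.lift_tmul fE C.val hcomm _ _
  have hV : finrank K (Fin d → N) = p * d := by
    rw [← finrank_mul_finrank K N (Fin d → N), hN]
    simp
  let e : End K (Fin d → N) ≃ₐ[K] Matrix (Fin (p * d)) (Fin (p * d)) K :=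
    algEquivMatrix ((finBasis K (Fin d → N)).reindex (finCongr hV))
  refine ⟨C, inferInstance, inferInstance, ⟨r, c, hC⟩, ?_,
    (e.restrictScalars F).toAlgHom.comp g₀, ?_⟩
  · have : Module.Free F C := Module.Free.of_divisionRing F C
    rw [finrank_tensorProduct, hA, hC.2.1]
    ring
  · have h1 : Set.range ((e.restrictScalars F).toAlgHom.comp g₀) =
        e.toLinearEquiv.toLinearMap '' Set.range g₀ := by
      rw [← Set.range_comp]; rfl
    rw [h1, Submodule.span_image, hg₀, Submodule.map_top]
    exact LinearEquiv.range _

end CyclicDescent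

section SplitsOver

/-- The algebra `A` has an absolutely irreducible `d`-dimensional representation over `Ω` whose
matrix entries lie in the intermediate field `N`. -/
def SplitsOver {F Ω : Type*} [Field F] [Field Ω] [Algebra F Ω] (A : Type*) [Ring A] [Algebra F A]
    (d : ℕ) (N : IntermediateField F Ω) : Prop :=
  ∃ f : A →ₐ[F] Matrix (Fin d) (Fin d) Ω, Submodule.span Ω (Set.range f) = ⊤ ∧
    ∀ a i j, f a i j ∈ N

lemma exists_corestrict_matrix {F Ω A N n : Type*} [Field F] [Field Ω] [Algebra F Ω] [Ring A]
    [Algebra F A] [Field N] [Algebra F N] [Fintype n] [DecidableEq n] (φ : N →ₐ[F] Ω)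
    (f : A →ₐ[F] Matrix n n Ω) (hf : ∀ a i j, f a i j ∈ φ.fieldRange) :
    ∃ g : A →ₐ[F] Matrix n n N, ∀ a, f a = φ.mapMatrix (g a) := by
  have hinj : Function.Injective (φ.mapMatrix (m := n)) := by
    intro M M' h
    ext i j
    exact φ.injective (congrFun (congrFun h i) j)
  have hmem : ∀ a, f a ∈ (φ.mapMatrix (m := n)).range := by
    intro a
    choose g hg using hf a
    exact ⟨Matrix.of g, Matrix.ext hg⟩
  refine ⟨(AlgEquiv.ofInjective _ hinj).symm.toAlgHom.comp (f.codRestrict _ hmem), fun a => ?_⟩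
  have := AlgEquiv.apply_symm_apply (AlgEquiv.ofInjective _ hinj) (f.codRestrict _ hmem a)
  exact (congrArg Subtype.val this).symm

variable {F Ω A : Type*} [Field F] [Field Ω] [Algebra F Ω] [Ring A] [Algebra F A] {d : ℕ}

lemma span_range_mapMatrix_iff {N n : Type*} [Field N] [Algebra F N] [Fintype n] [DecidableEq n]
    [Nonempty n] (hA : finrank F A = Fintype.card n ^ 2) (φ : N →ₐ[F] Ω)
    (g : A →ₐ[F] Matrix n n N) :
    Submodule.span Ω (Set.range (φ.mapMatrix.comp g)) = ⊤ ↔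
      Submodule.span N (Set.range g) = ⊤ := by
  have hcard := Fintype.card_pos (α := n)
  have : FiniteDimensional F A := FiniteDimensional.of_finrank_pos (by rw [hA]; positivity)
  let b := finBasis F A
  constructor
  · intro h
    obtain ⟨hli, -⟩ := linearIndependent_comp_basis_of_span_range_eq_top b _ h hA
    have hli' : LinearIndependent N (g ∘ b) := by
      rw [Fintype.linearIndependent_iff] at hli ⊢
      intro c hc i
      refine φ.injective ((hli (fun i => φ (c i)) ?_ i).trans (map_zero φ).symm)
      have := congrArg φ.mapMatrix hc
      rw [map_zero, map_sum] at this
      rw [← this]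
      refine Finset.sum_congr rfl fun i _ => ?_
      ext k l
      simp
    have hne : Nonempty (Fin (finrank F A)) := ⟨⟨0, by rw [hA]; positivity⟩⟩
    have hspan := hli'.span_eq_top_of_card_eq_finrank (by
      rw [Fintype.card_fin, hA, finrank_matrix]; simp [sq])
    rw [eq_top_iff, ← hspan]
    exact Submodule.span_mono (Set.range_comp_subset_range _ _)
  · intro h
    rw [eq_top_iff]
    have hmem : ∀ M : Matrix n n N, φ.mapMatrix M ∈
        Submodule.span Ω (Set.range (φ.mapMatrix.comp g)) := by
      intro M
      have hM : M ∈ Submodule.span N (Set.range g) := by rw [h]; trivial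
      induction hM using Submodule.span_induction with
      | mem M hM =>
        obtain ⟨a, rfl⟩ := hM
        exact Submodule.subset_span ⟨a, rfl⟩
      | zero => rw [map_zero]; exact zero_mem _
      | add _ _ _ _ h1 h2 => rw [map_add]; exact add_mem h1 h2
      | smul c M _ h1 =>
        have : φ.mapMatrix (c • M) = φ c • φ.mapMatrix M := by ext; simp
        rw [this]
        exact Submodule.smul_mem _ _ h1
    intro M _
    rw [Matrix.matrix_eq_sum_single M]
    refine Submodule.sum_mem _ fun i _ => Submodule.sum_mem _ fun j _ => ?_
    have : Matrix.single i j (M i j) = M i j • φ.mapMatrix (Matrix.single i j 1) := by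
      rw [AlgHom.mapMatrix_apply, Matrix.map_single, map_one, Matrix.smul_single, smul_eq_mul,
        mul_one]
    rw [this]
    exact Submodule.smul_mem _ _ (hmem _)

lemma splitsOver_fieldRange_iff {N : Type*} [Field N] [Algebra F N] (hd : 0 < d)
    (hA : finrank F A = d ^ 2) (φ : N →ₐ[F] Ω) :
    SplitsOver A d φ.fieldRange ↔
      ∃ g : A →ₐ[F] Matrix (Fin d) (Fin d) N, Submodule.span N (Set.range g) = ⊤ := by
  have hne : Nonempty (Fin d) := ⟨⟨0, hd⟩⟩
  constructor
  · rintro ⟨f, hf, hfN⟩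
    obtain ⟨g, hg⟩ := exists_corestrict_matrix φ f hfN
    obtain rfl : f = φ.mapMatrix.comp g := AlgHom.ext hg
    exact ⟨g, (span_range_mapMatrix_iff (by simpa using hA) φ g).1 hf⟩
  · rintro ⟨g, hg⟩
    exact ⟨φ.mapMatrix.comp g, (span_range_mapMatrix_iff (by simpa using hA) φ g).2 hg,
      fun a i j => ⟨g a i j, rfl⟩⟩

lemma SplitsOver.mono {N N' : IntermediateField F Ω} (h : SplitsOver A d N) (hN : N ≤ N') :
    SplitsOver A d N' := by
  obtain ⟨f, hf, hfN⟩ := h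
  exact ⟨f, hf, fun a i j => hN (hfN a i j)⟩

/-- Any representation with entries in `N` splits the algebra as soon as it is split somewhere. -/
lemma SplitsOver.of_algHom {N N' : IntermediateField F Ω} (hd : 0 < d) (hA : finrank F A = d ^ 2)
    (h : SplitsOver A d N) (g : A →ₐ[F] Matrix (Fin d) (Fin d) Ω) (hg : ∀ a i j, g a i j ∈ N') :
    SplitsOver A d N' := by
  have hne : Nonempty (Fin d) := ⟨⟨0, hd⟩⟩
  obtain ⟨f, hf, -⟩ := h
  obtain ⟨P, Q, hPQ, hQP, hconj⟩ :=
    exists_conj_of_span_range_eq_top f hf (by simpa using hA) rfl g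
  refine ⟨g, ?_, hg⟩
  let c : Matrix (Fin d) (Fin d) Ω →ₗ[Ω] Matrix (Fin d) (Fin d) Ω :=
    LinearMap.mulRight Ω Q ∘ₗ LinearMap.mulLeft Ω P
  have hr : Set.range g = c '' Set.range f := by
    rw [← Set.range_comp]
    congr 1
    funext a
    exact hconj a
  rw [hr, Submodule.span_image, hf, Submodule.map_top, LinearMap.range_eq_top]
  intro M
  refine ⟨Q * M * P, ?_⟩
  show P * (Q * M * P) * Q = M
  calc P * (Q * M * P) * Q = (P * Q) * M * (P * Q) := by simp only [mul_assoc]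
    _ = M := by rw [hPQ, one_mul, mul_one]

/-- Two representations with entries in `N` are conjugate by a matrix with entries in `N`. -/
lemma exists_conj_mem {N : IntermediateField F Ω} (hd : 0 < d) (hA : finrank F A = d ^ 2)
    (f g : A →ₐ[F] Matrix (Fin d) (Fin d) Ω) (hf : Submodule.span Ω (Set.range f) = ⊤)
    (hfN : ∀ a i j, f a i j ∈ N) (hgN : ∀ a i j, g a i j ∈ N) :
    ∃ P Q : Matrix (Fin d) (Fin d) Ω, P * Q = 1 ∧ Q * P = 1 ∧ (∀ i j, P i j ∈ N) ∧
      (∀ i j, Q i j ∈ N) ∧ ∀ a, g a = P * f a * Q := by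
  have hne : Nonempty (Fin d) := ⟨⟨0, hd⟩⟩
  have hN : N.val.fieldRange = N := N.fieldRange_val
  obtain ⟨f', hf'⟩ := exists_corestrict_matrix N.val f (by rwa [hN])
  obtain ⟨g', hg'⟩ := exists_corestrict_matrix N.val g (by rwa [hN])
  obtain rfl : f = N.val.mapMatrix.comp f' := AlgHom.ext hf'
  have hs := (span_range_mapMatrix_iff (by simpa using hA) N.val f').1 hf
  obtain ⟨P, Q, hPQ, hQP, hconj⟩ :=
    exists_conj_of_span_range_eq_top f' hs (by simpa using hA) rfl g'
  refine ⟨N.val.mapMatrix P, N.val.mapMatrix Q, ?_, ?_, fun i j => (P i j).2, fun i j => (Q i j).2,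
    fun a => ?_⟩
  · rw [← map_mul, hPQ, map_one]
  · rw [← map_mul, hQP, map_one]
  · rw [hg', hconj, map_mul, map_mul, AlgHom.comp_apply]

end SplitsOver

section Albert

open IntermediateField Polynomial

lemma pow_mem_range_of_mem_adjoin {p : ℕ} {F Ω : Type*} [Field F] [CharP F p] [Field Ω]
    [Algebra F Ω] (hp : p.Prime) {s : Set Ω} (hs : ∀ x ∈ s, ∃ c : F, x ^ p = algebraMap F Ω c)
    {y : Ω} (hy : y ∈ adjoin F s) : ∃ c : F, y ^ p = algebraMap F Ω c := by
  have : Fact p.Prime := ⟨hp⟩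
  have : CharP Ω p := charP_of_injective_algebraMap (algebraMap F Ω).injective p
  induction hy using adjoin_induction with
  | mem x hx => exact hs x hx
  | algebraMap r => exact ⟨r ^ p, (map_pow _ _ _).symm⟩
  | add x y _ _ hx hy =>
    obtain ⟨c, hc⟩ := hx
    obtain ⟨e, he⟩ := hy
    exact ⟨c + e, by rw [add_pow_char, hc, he, map_add]⟩
  | inv x _ hx =>
    obtain ⟨c, hc⟩ := hx
    exact ⟨c⁻¹, by rw [inv_pow, hc, map_inv₀]⟩
  | mul x y _ _ hx hy =>
    obtain ⟨c, hc⟩ := hx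
    obtain ⟨e, he⟩ := hy
    exact ⟨c * e, by rw [mul_pow, hc, he, map_mul]⟩

/-- In characteristic `p`, an algebra split by adjoining `p`-th roots of `m` elements of the base
field has `p`-symbol length at most `m`. -/
theorem symbolLengthLE_of_splitsOver_adjoin {p : ℕ} {F Ω : Type} [Field F] [CharP F p] [Field Ω]
    [Algebra F Ω] (hp : p.Prime) (s : Finset Ω) :
    ∀ (A : Type) [Ring A] [Algebra F A] (d m : ℕ), 0 < d → finrank F A = d ^ 2 →
      (∀ x ∈ s, ∃ c : F, x ^ p = algebraMap F Ω c) → SplitsOver A d (adjoin F (s : Set Ω)) →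
      s.card ≤ m → SymbolLengthLE p F A m := by
  have : Fact p.Prime := ⟨hp⟩
  have hΩ : CharP Ω p := charP_of_injective_algebraMap (algebraMap F Ω).injective p
  classical
  induction s using Finset.induction_on with
  | empty =>
    intro A _ _ d m hd hA _ hsplit _
    have h0 : adjoin F ((∅ : Finset Ω) : Set Ω) = (Algebra.ofId F Ω).fieldRange := by
      ext x
      simp [mem_bot, Algebra.ofId_apply]
    rw [h0, splitsOver_fieldRange_iff hd hA] at hsplit
    obtain ⟨g, hg⟩ := hsplit
    have hsurj : Function.Surjective g.toLinearMap := by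
      rw [← LinearMap.range_eq_top, ← hg]
      refine (Submodule.span_eq_of_le _ ?_ ?_).symm
      · rintro _ ⟨a, rfl⟩
        exact ⟨a, rfl⟩
      · rintro _ ⟨a, rfl⟩
        exact Submodule.subset_span ⟨a, rfl⟩
    have : FiniteDimensional F A := FiniteDimensional.of_finrank_pos (by rw [hA]; positivity)
    have hinj := (LinearMap.injective_iff_surjective_of_finrank_eq_finrank (f := g.toLinearMap)
      (by rw [hA, finrank_matrix]; simp [sq])).2 hsurj
    exact symbolLengthLE_of_algEquiv_matrix hd (AlgEquiv.ofBijective g ⟨hinj, hsurj⟩) m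
  | insert x s hxs ih =>
    intro A _ _ d m hd hA hs hsplit hm
    rw [Finset.card_insert_of_notMem hxs] at hm
    have hs' : ∀ y ∈ s, ∃ c : F, y ^ p = algebraMap F Ω c := fun y hy =>
      hs y (Finset.mem_insert_of_mem hy)
    by_cases hx : x ∈ adjoin F (s : Set Ω)
    · refine ih A d m hd hA hs' (hsplit.mono ?_) (by omega)
      rw [adjoin_le_iff, Finset.coe_insert, Set.insert_subset_iff]
      exact ⟨hx, subset_adjoin _ _⟩
    obtain ⟨c, hc⟩ := hs x (Finset.mem_insert_self x s)
    set K := adjoin F (s : Set Ω)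
    have hirr : Irreducible (X ^ p - C (algebraMap F K c)) := by
      refine X_pow_sub_C_irreducible_of_prime hp fun b hb => hx ?_
      have h1 : (b : Ω) ^ p = x ^ p := by
        rw [hc]
        exact congrArg (algebraMap K Ω) hb
      rw [← frobenius_inj Ω p h1]
      exact b.2
    have hmonic : (X ^ p - C (algebraMap F K c)).Monic := monic_X_pow_sub_C _ hp.ne_zero
    have hroot : aeval x (X ^ p - C (algebraMap F K c)) = 0 := by
      rw [map_sub, map_pow, aeval_X, aeval_C, hc, ← IsScalarTower.algebraMap_apply F K Ω, sub_self]
    have hmin := minpoly.eq_of_irreducible_of_monic hirr hroot hmonic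
    have hxint : IsIntegral K x := ⟨_, hmonic, hroot⟩
    let pb := adjoin.powerBasis hxint
    have hdim : pb.dim = p := by
      rw [adjoin.powerBasis_dim, ← hmin, natDegree_X_pow_sub_C]
    let B : Basis (Fin p) K K⟮x⟯ := pb.basis.reindex (finCongr hdim)
    have hB : ∀ k, B k = (AdjoinSimple.gen K x) ^ (k : ℕ) := fun k => by
      simp [B, pb]
    let φ : K⟮x⟯ →ₐ[F] Ω := K⟮x⟯.val.restrictScalars F
    have hφ : φ.fieldRange = adjoin F ((insert x s : Finset Ω) : Set Ω) := by
      have h1 := adjoin_adjoin_left F (s : Set Ω) {x}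
      rw [Finset.coe_insert, Set.insert_eq, Set.union_comm, ← h1]
      ext y
      exact ⟨fun ⟨z, hz⟩ => hz ▸ z.2, fun hy => ⟨⟨y, hy⟩, rfl⟩⟩
    rw [← hφ, splitsOver_fieldRange_iff hd hA] at hsplit
    obtain ⟨f, hf⟩ := hsplit
    have hKp : ∀ y : K, ∃ r : F, y ^ p = algebraMap F K r := fun y => by
      obtain ⟨r, hr⟩ := pow_mem_range_of_mem_adjoin hp (s := (s : Set Ω))
        (fun x hx => hs' x hx) y.2
      exact ⟨r, Subtype.ext hr⟩
    have hx0 : AdjoinSimple.gen K x ≠ 0 := by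
      intro h0
      have : x = 0 := congrArg Subtype.val h0
      exact hx (this ▸ zero_mem K)
    obtain ⟨E, _, _, hE, hfin, g, hg⟩ := exists_cyclic_tensor_algHom hp hd hKp hx0
      (c := c) (Subtype.ext hc) B hB f hf hA
    obtain ⟨m, rfl⟩ : ∃ m', m = m' + 1 := ⟨m - 1, by omega⟩
    refine SymbolLengthLE.of_tensor hp hE (ih (A ⊗[F] E) (p * d) m (Nat.mul_pos hp.pos hd) hfin hs'
      ?_ (by omega))
    have := (splitsOver_fieldRange_iff (Nat.mul_pos hp.pos hd) hfin K.val).2 ⟨g, hg⟩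
    rwa [K.fieldRange_val] at this

end Albert

section CyclicStep

open IntermediateField Polynomial

variable {F Ω : Type*} [Field F] [Field Ω] [Algebra F Ω] {p : ℕ}

/-- The elements of `Ω` whose `p`-th power lies in `F'`, in characteristic `p`. -/
def pthRoots (p : ℕ) [Fact p.Prime] [CharP Ω p] (F' : IntermediateField F Ω) :
    IntermediateField F Ω where
  carrier := {x | x ^ p ∈ F'}
  mul_mem' {x y} hx hy := by
    show (x * y) ^ p ∈ F'
    rw [mul_pow]
    exact mul_mem hx hy
  add_mem' {x y} hx hy := by
    show (x + y) ^ p ∈ F'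
    rw [add_pow_char]
    exact add_mem hx hy
  algebraMap_mem' r := by
    show (algebraMap F Ω r) ^ p ∈ F'
    rw [← map_pow]
    exact F'.algebraMap_mem _
  inv_mem' x hx := by
    show (x⁻¹) ^ p ∈ F'
    rw [inv_pow]
    exact inv_mem hx

lemma mem_pthRoots [Fact p.Prime] [CharP Ω p] {F' : IntermediateField F Ω} {x : Ω} :
    x ∈ pthRoots p F' ↔ x ^ p ∈ F' := Iff.rfl

lemma le_pthRoots [Fact p.Prime] [CharP Ω p] (F' : IntermediateField F Ω) :
    F' ≤ pthRoots p F' := fun _ hx =>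
  pow_mem hx p

/-- `K` is a cyclic extension of degree `p` of `F'`, with basis `e`, whose Galois group is generated
by the restriction of `σ`. -/
structure IsCyclicStep (p : ℕ) (F' K : IntermediateField F Ω) (σ : Ω ≃ₐ[F] Ω) (e : Fin p → Ω) :
    Prop where
  le : F' ≤ K
  map_eq_of_mem : ∀ x ∈ F', σ x = x
  map_mem : ∀ x ∈ K, σ x ∈ K
  pow_apply : ∀ x ∈ K, (σ ^ p) x = x
  mem_of_map_eq : ∀ x ∈ K, σ x = x → x ∈ F'
  basis_mem : ∀ k, e k ∈ K
  exists_repr : ∀ x ∈ K, ∃ y : Fin p → Ω, (∀ k, y k ∈ F') ∧ x = ∑ k, y k * e k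
  exists_repr_pow : ∀ x ∈ K, ∃ y : Fin p → Ω, (∀ k, y k ∈ F') ∧ x = ∑ k, y k * e k ^ p
  eq_zero_of_sum : ∀ c : ℕ → Ω, (∀ x ∈ K, ∑ k ∈ Finset.range p, c k * (σ ^ k) x = 0) →
    ∀ k < p, c k = 0

/-- The trace `∑ k < p, σ ^ k x`. -/
def orbitSum (p : ℕ) (σ : Ω ≃ₐ[F] Ω) (x : Ω) : Ω := ∑ k ∈ Finset.range p, (σ ^ k) x

lemma map_orbitSum (σ : Ω ≃ₐ[F] Ω) {x : Ω} (hx : (σ ^ p) x = x) :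
    σ (orbitSum p σ x) = orbitSum p σ x := by
  have h1 := Finset.sum_range_succ (fun k => (σ ^ k) x) p
  rw [Finset.sum_range_succ', hx] at h1
  rw [orbitSum, map_sum]
  simp only [pow_succ', AlgEquiv.mul_apply, pow_zero, AlgEquiv.one_apply] at h1
  exact add_right_cancel h1

lemma pow_apply_of_map_eq {σ : Ω ≃ₐ[F] Ω} {y : Ω} (hy : σ y = y) (k : ℕ) : (σ ^ k) y = y := by
  induction k with
  | zero => rfl
  | succ k ih => rw [pow_succ, AlgEquiv.mul_apply, hy, ih]

lemma orbitSum_sum_mul {ι : Type*} (s : Finset ι) (σ : Ω ≃ₐ[F] Ω) {y : ι → Ω}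
    (hy : ∀ i, σ (y i) = y i) (x : ι → Ω) :
    orbitSum p σ (∑ i ∈ s, y i * x i) = ∑ i ∈ s, y i * orbitSum p σ (x i) := by
  simp only [orbitSum, map_sum, map_mul, pow_apply_of_map_eq (hy _), Finset.mul_sum]
  exact Finset.sum_comm

namespace IsCyclicStep

variable {F' K M : IntermediateField F Ω} {σ : Ω ≃ₐ[F] Ω} {e : Fin p → Ω}

lemma pow_mem (h : IsCyclicStep p F' K σ e) {x : Ω} (hx : x ∈ K) (k : ℕ) : (σ ^ k) x ∈ K := by
  induction k with
  | zero => exact hx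
  | succ k ih => rw [pow_succ', AlgEquiv.mul_apply]; exact h.map_mem _ ih

lemma orbitSum_mem (h : IsCyclicStep p F' K σ e) {x : Ω} (hx : x ∈ K) : orbitSum p σ x ∈ F' :=
  h.mem_of_map_eq _ (sum_mem fun k _ => h.pow_mem hx k) (map_orbitSum σ (h.pow_apply x hx))

lemma exists_orbitSum_eq_one (h : IsCyclicStep p F' K σ e) (hp : 0 < p) :
    ∃ t ∈ K, orbitSum p σ t = 1 := by
  obtain ⟨x, hx, hne⟩ : ∃ x ∈ K, orbitSum p σ x ≠ 0 := by
    by_contra! hcon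
    have := h.eq_zero_of_sum (fun _ => 1) (fun x hx => by simpa [orbitSum] using hcon x hx) 0 hp
    exact one_ne_zero this
  refine ⟨(orbitSum p σ x)⁻¹ * x, mul_mem (inv_mem (h.le (h.orbitSum_mem hx))) hx, ?_⟩
  have := orbitSum_sum_mul (p := p) (Finset.univ : Finset Unit) σ
    (y := fun _ => (orbitSum p σ x)⁻¹)
    (fun _ => h.map_eq_of_mem _ (inv_mem (h.orbitSum_mem hx))) (fun _ => x)
  simpa [hne] using this

lemma mem_sup_iff [Algebra.IsAlgebraic F Ω] (h : IsCyclicStep p F' K σ e) (hM : F' ≤ M) {x : Ω} :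
    x ∈ M ⊔ K ↔ ∃ y : Fin p → Ω, (∀ k, y k ∈ M) ∧ x = ∑ k, y k * e k := by
  constructor
  · intro hx
    have hx' : x ∈ Subalgebra.toSubmodule M.toSubalgebra *
        Subalgebra.toSubmodule K.toSubalgebra := by
      rw [Subalgebra.mul_toSubmodule, ← sup_toSubalgebra_of_isAlgebraic_left]
      exact hx
    refine Submodule.mul_induction_on hx' (fun m hm n hn => ?_) fun x₁ x₂ h₁ h₂ => ?_
    · obtain ⟨y, hy, hny⟩ := h.exists_repr n hn
      refine ⟨fun k => m * y k, fun k => mul_mem hm (hM (hy k)), ?_⟩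
      rw [hny, Finset.mul_sum]
      exact Finset.sum_congr rfl fun k _ => (mul_assoc _ _ _).symm
    · obtain ⟨y₁, hy₁, rfl⟩ := h₁
      obtain ⟨y₂, hy₂, rfl⟩ := h₂
      refine ⟨fun k => y₁ k + y₂ k, fun k => add_mem (hy₁ k) (hy₂ k), ?_⟩
      simp only [add_mul, Finset.sum_add_distrib]
  · rintro ⟨y, hy, rfl⟩
    exact sum_mem fun k _ => mul_mem ((le_sup_left : M ≤ M ⊔ K) (hy k))
      ((le_sup_right : K ≤ M ⊔ K) (h.basis_mem k))

section CharP

variable [hpF : Fact p.Prime] [CharP Ω p]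

lemma map_eq_of_mem_pthRoots (h : IsCyclicStep p F' K σ e) {x : Ω} (hx : x ∈ pthRoots p F') :
    σ x = x := by
  refine frobenius_inj Ω p ?_
  rw [frobenius_def, frobenius_def, ← map_pow, h.map_eq_of_mem _ hx]

variable [Algebra.IsAlgebraic F Ω]

lemma map_mem_sup (h : IsCyclicStep p F' K σ e) (hM : F' ≤ M) (hME : M ≤ pthRoots p F') {x : Ω}
    (hx : x ∈ M ⊔ K) : σ x ∈ M ⊔ K := by
  obtain ⟨y, hy, rfl⟩ := (h.mem_sup_iff hM).1 hx
  rw [map_sum]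
  refine sum_mem fun k _ => ?_
  rw [map_mul, h.map_eq_of_mem_pthRoots (hME (hy k))]
  exact mul_mem ((le_sup_left : M ≤ M ⊔ K) (hy k))
    ((le_sup_right : K ≤ M ⊔ K) (h.map_mem _ (h.basis_mem k)))

lemma pow_mem_sup (h : IsCyclicStep p F' K σ e) (hM : F' ≤ M) (hME : M ≤ pthRoots p F') {x : Ω}
    (hx : x ∈ M ⊔ K) (k : ℕ) : (σ ^ k) x ∈ M ⊔ K := by
  induction k with
  | zero => exact hx
  | succ k ih => rw [pow_succ', AlgEquiv.mul_apply]; exact h.map_mem_sup hM hME ih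

lemma pow_apply_of_mem_sup (h : IsCyclicStep p F' K σ e) (hM : F' ≤ M) (hME : M ≤ pthRoots p F')
    {x : Ω} (hx : x ∈ M ⊔ K) : (σ ^ p) x = x := by
  obtain ⟨y, hy, rfl⟩ := (h.mem_sup_iff hM).1 hx
  rw [map_sum]
  refine Finset.sum_congr rfl fun k _ => ?_
  rw [map_mul, pow_apply_of_map_eq (h.map_eq_of_mem_pthRoots (hME (hy k))),
    h.pow_apply _ (h.basis_mem k)]

lemma mem_of_mem_sup_of_map_eq (h : IsCyclicStep p F' K σ e) (hM : F' ≤ M)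
    (hME : M ≤ pthRoots p F') {x : Ω} (hx : x ∈ M ⊔ K) (hσ : σ x = x) : x ∈ M := by
  obtain ⟨t, ht, ht1⟩ := h.exists_orbitSum_eq_one hpF.out.pos
  obtain ⟨y, hy, hxy⟩ := (h.mem_sup_iff hM).1 hx
  have h1 := orbitSum_sum_mul (p := p) (Finset.univ : Finset Unit) σ (y := fun _ => x)
    (fun _ => hσ) (fun _ => t)
  have h2 := orbitSum_sum_mul (p := p) Finset.univ σ (y := y)
    (fun k => h.map_eq_of_mem_pthRoots (hME (hy k))) (fun k => e k * t)
  simp only [Finset.univ_unique, Finset.sum_const, Finset.card_singleton, one_smul, ht1,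
    mul_one] at h1
  rw [← h1]
  nth_rewrite 1 [hxy]
  rw [Finset.sum_mul]
  simp only [mul_assoc]
  rw [h2]
  exact sum_mem fun k _ => mul_mem (hy k) (hM (h.orbitSum_mem (mul_mem (h.basis_mem k) ht)))

end CharP

end IsCyclicStep

/-- A simple root of a polynomial with coefficients in `N` which is purely inseparable over `N` lies
in `N`. -/
lemma mem_of_pow_mem_of_eval_derivative_ne_zero [Fact p.Prime] [CharP Ω p]
    (N : IntermediateField F Ω) {x : Ω} (hx : x ^ p ∈ N) (q : N[X]) (hq : aeval x q = 0)
    (hq' : aeval x (derivative q) ≠ 0) : x ∈ N := by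
  have : CharP N p := (N.toSubfield.subtype.charP_iff N.toSubfield.subtype.injective p).2 ‹_›
  have hq0 : q ≠ 0 := by rintro rfl; simp at hq'
  have hxint : IsIntegral N x := isAlgebraic_iff_isIntegral.1 ⟨q, hq0, hq⟩
  have hsep : IsSeparable N x := by
    rw [IsSeparable, separable_iff_derivative_ne_zero (minpoly.irreducible hxint)]
    intro h0
    obtain ⟨r, rfl⟩ := minpoly.dvd N x hq
    rw [derivative_mul, h0] at hq'
    simp at hq'
  have hins : x ∈ perfectClosure N Ω :=
    (mem_perfectClosure_iff_pow_mem p).2 ⟨1, ⟨x ^ p, hx⟩, by simp⟩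
  have hmem : x ∈ separableClosure N Ω ⊓ perfectClosure N Ω :=
    ⟨mem_separableClosure_iff.2 hsep, hins⟩
  rw [separableClosure_inf_perfectClosure, mem_bot] at hmem
  obtain ⟨y, rfl⟩ := hmem
  exact y.2

/-- If `b ∈ M` is a norm from `E ⊔ K`, where `E` consists of all `p`-th roots of elements of `F'`,
then it is a norm from `M' ⊔ K` with `M'` generated over `M` by `p - 1` elements of `E`. -/
lemma IsCyclicStep.exists_norm_mem_sup_adjoin [hpF : Fact p.Prime] [CharP Ω p]
    [Algebra.IsAlgebraic F Ω] {F' K : IntermediateField F Ω} {σ : Ω ≃ₐ[F] Ω} {e : Fin p → Ω}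
    (h : IsCyclicStep p F' K σ e) {b z : Ω} (hb : b ≠ 0) (hz : z ∈ pthRoots p F' ⊔ K)
    (hzb : ∏ k ∈ Finset.range p, (σ ^ k) z = b) :
    ∃ s : Finset Ω, s.card ≤ p - 1 ∧ (∀ x ∈ s, x ^ p ∈ F') ∧
      ∀ M, F' ≤ M → M ≤ pthRoots p F' → b ∈ M → (s : Set Ω) ⊆ M → z ∈ M ⊔ K := by
  classical
  obtain ⟨y, hy, hzy⟩ := (h.mem_sup_iff (le_pthRoots F')).1 hz
  have hz0 : z ≠ 0 := by
    rintro rfl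
    apply hb
    rw [← hzb]
    exact Finset.prod_eq_zero (Finset.mem_range.2 hpF.out.pos) (map_zero _)
  obtain ⟨j, hj⟩ : ∃ j, orbitSum p σ (e j * z⁻¹) ≠ 0 := by
    by_contra! hcon
    obtain ⟨t, ht, ht1⟩ := h.exists_orbitSum_eq_one hpF.out.pos
    obtain ⟨w, hw, hwt⟩ := (h.mem_sup_iff (le_pthRoots F')).1
      (mul_mem ((le_sup_right : K ≤ pthRoots p F' ⊔ K) ht) hz)
    have h2 := orbitSum_sum_mul (p := p) Finset.univ σ (y := w)
      (fun k => h.map_eq_of_mem_pthRoots (hw k)) (fun k => e k * z⁻¹)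
    simp only [hcon, mul_zero, Finset.sum_const_zero, ← mul_assoc] at h2
    rw [← Finset.sum_mul, ← hwt, mul_assoc, mul_inv_cancel₀ hz0, mul_one, ht1] at h2
    exact one_ne_zero h2
  refine ⟨(Finset.univ.erase j).image y, ?_, ?_, fun M hM hME hbM hs => ?_⟩
  · refine Finset.card_image_le.trans ?_
    rw [Finset.card_erase_of_mem (Finset.mem_univ _), Finset.card_univ, Fintype.card_fin]
  · intro x hx
    obtain ⟨k, -, rfl⟩ := Finset.mem_image.1 hx
    exact hy k
  set N := M ⊔ K
  have hMN : M ≤ N := le_sup_left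
  have hKN : K ≤ N := le_sup_right
  let u := ∑ k ∈ Finset.univ.erase j, y k * e k
  have hu : u ∈ N := sum_mem fun k hk =>
    mul_mem (hMN (hs (Finset.mem_coe.2 (Finset.mem_image_of_mem y hk)))) (hKN (h.basis_mem k))
  have hzu : z = y j * e j + u := by
    rw [hzy, ← Finset.add_sum_erase _ _ (Finset.mem_univ j)]
  let e' : ℕ → N := fun k => ⟨(σ ^ k) (e j), hKN (h.pow_mem (h.basis_mem j) k)⟩
  let u' : ℕ → N := fun k => ⟨(σ ^ k) u, h.pow_mem_sup hM hME hu k⟩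
  let b' : N := ⟨b, hMN hbM⟩
  let q : N[X] := ∏ k ∈ Finset.range p, (C (e' k) * X + C (u' k)) - C b'
  have hyj : σ (y j) = y j := h.map_eq_of_mem_pthRoots (hy j)
  have hlin : ∀ k, aeval (y j) (C (e' k) * X + C (u' k)) = (σ ^ k) z := fun k => by
    rw [hzu, map_add, map_mul, map_add, map_mul, aeval_C, aeval_C, aeval_X,
      pow_apply_of_map_eq hyj, mul_comm]
    rfl
  have hq : aeval (y j) q = 0 := by
    rw [map_sub, map_prod, Finset.prod_congr rfl fun k _ => hlin k, hzb, aeval_C, sub_eq_zero]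
    rfl
  have hq' : aeval (y j) (derivative q) ≠ 0 := by
    have : aeval (y j) (derivative q) = b * orbitSum p σ (e j * z⁻¹) := by
      rw [derivative_sub, derivative_C, sub_zero, derivative_prod_finset, map_sum, orbitSum,
        Finset.mul_sum]
      refine Finset.sum_congr rfl fun k hk => ?_
      rw [map_mul, map_prod, Finset.prod_congr rfl fun k _ => hlin k, ← hzb,
        ← Finset.mul_prod_erase _ _ hk, map_mul, map_inv₀]
      have hk0 : (σ ^ k) z ≠ 0 := (_root_.map_ne_zero _).2 hz0
      have : aeval (y j) (derivative (C (e' k) * X + C (u' k))) = (σ ^ k) (e j) := by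
        simp [e', derivative_mul]
      rw [this]
      field_simp
    rw [this]
    exact mul_ne_zero hb hj
  have hmem := mem_of_pow_mem_of_eval_derivative_ne_zero N (hKN (h.le (hy j))) q hq hq'
  rw [hzu]
  exact add_mem (mul_mem hmem (hKN (h.basis_mem j))) hu

end CyclicStep

section Descent

open IntermediateField

variable {F Ω A : Type*} [Field F] [Field Ω] [Algebra F Ω] [Ring A] [Algebra F A] {d p : ℕ}

/-- The twisted power `P * σ P * ⋯ * σ ^ (k - 1) P`. -/
def twistedPow (σ : Ω ≃ₐ[F] Ω) (P : Matrix (Fin d) (Fin d) Ω) : ℕ → Matrix (Fin d) (Fin d) Ω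
  | 0 => 1
  | k + 1 => twistedPow σ P k * P.map (σ ^ k)

variable (σ : Ω ≃ₐ[F] Ω)

lemma map_algEquiv_mul (M N : Matrix (Fin d) (Fin d) Ω) :
    (M * N).map σ = M.map σ * N.map σ := Matrix.map_mul

lemma map_algEquiv_map_pow (M : Matrix (Fin d) (Fin d) Ω) (k : ℕ) :
    (M.map (σ ^ k)).map σ = M.map (σ ^ (k + 1)) := by
  ext i j
  simp only [Matrix.map_apply, pow_succ', AlgEquiv.mul_apply]

lemma map_algEquiv_pow_map (M : Matrix (Fin d) (Fin d) Ω) (k : ℕ) :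
    (M.map σ).map (σ ^ k) = M.map (σ ^ (k + 1)) := by
  ext i j
  simp only [Matrix.map_apply, pow_succ, AlgEquiv.mul_apply]

lemma twistedPow_succ' (P : Matrix (Fin d) (Fin d) Ω) (k : ℕ) :
    twistedPow σ P (k + 1) = P * (twistedPow σ P k).map σ := by
  induction k with
  | zero =>
    have h1 : P.map ⇑(σ ^ 0) = P := by ext; rfl
    have h2 : (1 : Matrix (Fin d) (Fin d) Ω).map σ = 1 :=
      Matrix.map_one _ (map_zero _) (map_one _)
    simp only [twistedPow, h1, h2, one_mul, mul_one]
  | succ k ih =>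
    calc twistedPow σ P (k + 1 + 1) = twistedPow σ P (k + 1) * P.map (σ ^ (k + 1)) := rfl
      _ = P * ((twistedPow σ P k).map σ * (P.map (σ ^ k)).map σ) := by
        rw [ih, map_algEquiv_map_pow, mul_assoc]
      _ = P * (twistedPow σ P (k + 1)).map σ := by rw [← map_algEquiv_mul]; rfl

variable {σ}

lemma twistedPow_intertwine {P X : Matrix (Fin d) (Fin d) Ω} (h : X * P = P * X.map σ) (k : ℕ) :
    X * twistedPow σ P k = twistedPow σ P k * X.map (σ ^ k) := by
  induction k with
  | zero =>
    have h1 : X.map ⇑(σ ^ 0) = X := by ext; rfl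
    simp only [twistedPow, h1, one_mul, mul_one]
  | succ k ih =>
    have h1 := congrArg (fun M => M.map (σ ^ k)) h
    simp only [map_algEquiv_mul, map_algEquiv_pow_map] at h1
    simp only [twistedPow]
    rw [← mul_assoc, ih, mul_assoc, h1, mul_assoc]

lemma isUnit_twistedPow {P : Matrix (Fin d) (Fin d) Ω} (hP : IsUnit P) (k : ℕ) :
    IsUnit (twistedPow σ P k) := by
  induction k with
  | zero => exact isUnit_one
  | succ k ih => exact ih.mul (hP.map (σ ^ k).mapMatrix)

lemma twistedPow_smul (c : Ω) (P : Matrix (Fin d) (Fin d) Ω) (k : ℕ) :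
    twistedPow σ (c • P) k = (∏ i ∈ Finset.range k, (σ ^ i) c) • twistedPow σ P k := by
  induction k with
  | zero => simp [twistedPow]
  | succ k ih =>
    have h1 : (c • P).map (σ ^ k) = (σ ^ k) c • P.map (σ ^ k) := by
      ext i j
      exact map_mul (σ ^ k) c (P i j)
    simp only [twistedPow]
    rw [ih, h1, Finset.prod_range_succ, smul_mul_smul_comm]

lemma twistedPow_mul_map {P Q : Matrix (Fin d) (Fin d) Ω} {z : Ω} (h : P * Q.map σ = z • Q)
    (k : ℕ) :
    twistedPow σ P k * Q.map (σ ^ k) = (∏ i ∈ Finset.range k, (σ ^ i) z) • Q := by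
  induction k with
  | zero =>
    have h1 : Q.map ⇑(σ ^ 0) = Q := by ext; rfl
    simp only [twistedPow, h1, one_mul, Finset.range_zero, Finset.prod_empty, one_smul]
  | succ k ih =>
    have h1 := congrArg (fun M => M.map (σ ^ k)) h
    have h2 : (z • Q).map (σ ^ k) = (σ ^ k) z • Q.map (σ ^ k) := by
      ext i j
      exact map_mul (σ ^ k) z (Q i j)
    simp only [map_algEquiv_mul, map_algEquiv_pow_map, h2] at h1
    simp only [twistedPow]
    rw [mul_assoc, h1, Matrix.mul_smul, ih, smul_smul, Finset.prod_range_succ, mul_comm]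

lemma matrix_mul_mem {N : IntermediateField F Ω} {P Q : Matrix (Fin d) (Fin d) Ω}
    (hP : ∀ i j, P i j ∈ N) (hQ : ∀ i j, Q i j ∈ N) (i j : Fin d) : (P * Q) i j ∈ N := by
  rw [Matrix.mul_apply]
  exact sum_mem fun k _ => mul_mem (hP i k) (hQ k j)

lemma exists_inverse_mem {N : IntermediateField F Ω} {W : Matrix (Fin d) (Fin d) Ω}
    (hW : IsUnit W) (hWN : ∀ i j, W i j ∈ N) :
    ∃ V : Matrix (Fin d) (Fin d) Ω, V * W = 1 ∧ W * V = 1 ∧ ∀ i j, V i j ∈ N := by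
  let W' : Matrix (Fin d) (Fin d) N := Matrix.of fun i j => ⟨W i j, hWN i j⟩
  have hW' : N.val.mapMatrix W' = W := rfl
  have hdet : IsUnit W'.det := by
    rw [Matrix.isUnit_iff_isUnit_det, ← hW', ← AlgHom.map_det] at hW
    rw [isUnit_iff_ne_zero] at hW ⊢
    exact fun h0 => hW (by rw [h0, map_zero])
  refine ⟨N.val.mapMatrix W'⁻¹, ?_, ?_, fun i j => (W'⁻¹ i j).2⟩
  · rw [← hW', ← map_mul, Matrix.nonsing_inv_mul _ hdet, map_one]
  · rw [← hW', ← map_mul, Matrix.mul_nonsing_inv _ hdet, map_one]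

variable [hpF : Fact p.Prime] [CharP Ω p] [Algebra.IsAlgebraic F Ω]
  {F' K M : IntermediateField F Ω} {e : Fin p → Ω}

lemma IsCyclicStep.twistedPow_mem (h : IsCyclicStep p F' K σ e) (hM : F' ≤ M)
    (hME : M ≤ pthRoots p F') {P : Matrix (Fin d) (Fin d) Ω} (hP : ∀ i j, P i j ∈ M ⊔ K) (k : ℕ) :
    ∀ i j, twistedPow σ P k i j ∈ M ⊔ K := by
  induction k with
  | zero =>
    intro i j
    simp only [twistedPow, Matrix.one_apply]
    split_ifs
    · exact one_mem _
    · exact zero_mem _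
  | succ k ih => exact matrix_mul_mem ih fun i j => h.pow_mem_sup hM hME (hP i j) k

/-- A cocycle with values in invertible matrices is a coboundary. -/
lemma IsCyclicStep.exists_isUnit_mul_map_eq (h : IsCyclicStep p F' K σ e) (hM : F' ≤ M)
    (hME : M ≤ pthRoots p F') {P : Matrix (Fin d) (Fin d) Ω} (hP : ∀ i j, P i j ∈ M ⊔ K)
    (hP1 : twistedPow σ P p = 1) :
    ∃ W : Matrix (Fin d) (Fin d) Ω, IsUnit W ∧ (∀ i j, W i j ∈ M ⊔ K) ∧ P * W.map σ = W := by
  let w : Ω → Fin d → Fin d → Ω := fun c i l =>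
    ∑ k ∈ Finset.range p, twistedPow σ P k l i * (σ ^ k) c
  let S : Set (Fin d → Ω) := {v | ∃ c ∈ K, ∃ i, v = w c i}
  have hSN : ∀ v ∈ S, ∀ l, v l ∈ M ⊔ K := by
    rintro _ ⟨c, hc, i, rfl⟩ l
    exact sum_mem fun k _ => mul_mem (h.twistedPow_mem hM hME hP k l i)
      ((le_sup_right : K ≤ M ⊔ K) (h.pow_mem hc k))
  have hSfix : ∀ v ∈ S, ∀ l, ∑ m, P l m * σ (v m) = v l := by
    rintro _ ⟨c, hc, i, rfl⟩ l
    have h1 : ∀ k, ∑ m, P l m * σ (twistedPow σ P k m i * (σ ^ k) c) =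
        twistedPow σ P (k + 1) l i * (σ ^ (k + 1)) c := fun k => by
      rw [twistedPow_succ', Matrix.mul_apply, Finset.sum_mul]
      refine Finset.sum_congr rfl fun m _ => ?_
      rw [map_mul, pow_succ', AlgEquiv.mul_apply, Matrix.map_apply, mul_assoc]
    simp only [w, map_sum, Finset.mul_sum]
    rw [Finset.sum_comm, Finset.sum_congr rfl fun k _ => h1 k]
    have h2 := Finset.sum_range_succ (fun k => twistedPow σ P k l i * (σ ^ k) c) p
    rw [Finset.sum_range_succ', hP1, h.pow_apply c hc] at h2
    exact add_right_cancel h2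
  have hspan : Submodule.span Ω S = ⊤ := by
    by_contra hne
    obtain ⟨ℓ, hℓ, hker⟩ := Submodule.exists_le_ker_of_lt_top _ (lt_top_iff_ne_top.2 hne)
    refine hℓ (LinearMap.pi_ext' fun i => LinearMap.ext_ring ?_)
    have h1 := h.eq_zero_of_sum (fun k => ℓ fun l => twistedPow σ P k l i) (fun c hc => by
      have h2 : ℓ (w c i) = 0 := hker (Submodule.subset_span ⟨c, hc, i, rfl⟩)
      have h3 : w c i = ∑ k ∈ Finset.range p, (σ ^ k) c • fun l => twistedPow σ P k l i := by
        ext l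
        simp [w, mul_comm]
      rw [h3, map_sum] at h2
      simpa [mul_comm] using h2) 0 hpF.out.pos
    have h4 : (fun l => twistedPow σ P 0 l i) = Pi.single i 1 := by
      ext l
      simp [twistedPow, Matrix.one_apply, Pi.single_apply]
    simpa [h4] using h1
  obtain ⟨v, hvS, -, hli⟩ := Submodule.exists_fun_fin_finrank_span_eq Ω S
  have hfin : finrank Ω (Submodule.span Ω S) = d := by
    rw [hspan, finrank_top, finrank_fin_fun]
  let v' : Fin d → Fin d → Ω := v ∘ finCongr hfin.symm
  refine ⟨Matrix.of fun l m => v' m l, ?_, fun i j => hSN _ (hvS _) i, ?_⟩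
  · rw [← Matrix.linearIndependent_cols_iff_isUnit]
    exact hli.comp _ (finCongr hfin.symm).injective
  · ext l m
    rw [Matrix.mul_apply]
    exact hSfix _ (hvS _) l

/-- Galois descent for split algebras along a cyclic step. -/
lemma IsCyclicStep.splitsOver_of_twistedPow_eq_one (h : IsCyclicStep p F' K σ e) (hM : F' ≤ M)
    (hME : M ≤ pthRoots p F') (hd : 0 < d) (hA : finrank F A = d ^ 2)
    (f : A →ₐ[F] Matrix (Fin d) (Fin d) Ω) (hf : Submodule.span Ω (Set.range f) = ⊤)
    (hfN : ∀ a i j, f a i j ∈ M ⊔ K) {P : Matrix (Fin d) (Fin d) Ω} (hP : ∀ i j, P i j ∈ M ⊔ K)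
    (hfP : ∀ a, f a * P = P * (f a).map σ) (hP1 : twistedPow σ P p = 1) : SplitsOver A d M := by
  obtain ⟨W, hW, hWN, hPW⟩ := h.exists_isUnit_mul_map_eq hM hME hP hP1
  obtain ⟨V, hVW, hWV, hVN⟩ := exists_inverse_mem hW hWN
  let g : A →ₐ[F] Matrix (Fin d) (Fin d) Ω := AlgHom.ofLinearMap
    (LinearMap.mulRight F W ∘ₗ LinearMap.mulLeft F V ∘ₗ f.toLinearMap)
    (by simp [hVW])
    (fun a b => by
      show V * f (a * b) * W = V * f a * W * (V * f b * W)
      calc V * f (a * b) * W = V * f a * 1 * f b * W := by simp only [map_mul, mul_assoc, one_mul]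
        _ = _ := by rw [← hWV]; simp only [mul_assoc])
  have hg : ∀ a, g a = V * f a * W := fun a => rfl
  refine SplitsOver.of_algHom hd hA (N := M ⊔ K) ⟨f, hf, hfN⟩ g fun a i j => ?_
  refine h.mem_of_mem_sup_of_map_eq hM hME ?_ ?_
  · rw [hg]
    exact matrix_mul_mem (matrix_mul_mem hVN (hfN a)) hWN i j
  · have h1 : W * (g a).map σ = W * g a := by
      have hW1 : W * (V.map σ) = P := by
        nth_rewrite 1 [← hPW]
        rw [mul_assoc, ← map_algEquiv_mul, hWV, Matrix.map_one _ (map_zero _) (map_one _), mul_one]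
      rw [hg, map_algEquiv_mul, map_algEquiv_mul, ← mul_assoc, ← mul_assoc, hW1, ← hfP, mul_assoc,
        hPW, mul_assoc V, ← mul_assoc W, hWV, one_mul]
    have h2 : (g a).map σ = g a := by
      calc (g a).map σ = V * (W * (g a).map σ) := by rw [← mul_assoc, hVW, one_mul]
        _ = g a := by rw [h1, ← mul_assoc, hVW, one_mul]
    exact congrFun (congrFun h2 i) j

/-- The norm criterion: if `A` splits over `M ⊔ K`, there is `b ∈ M` such that for `M ≤ M'`, the
algebra `A` splits over `M'` as soon as `b` is a norm from `M' ⊔ K`, and conversely for the field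
of all `p`-th roots. -/
lemma IsCyclicStep.exists_norm_criterion (h : IsCyclicStep p F' K σ e) (hM : F' ≤ M)
    (hME : M ≤ pthRoots p F') (hd : 0 < d) (hA : finrank F A = d ^ 2)
    (hsplit : SplitsOver A d (M ⊔ K)) :
    ∃ b ∈ M, b ≠ 0 ∧
      (∀ M', M ≤ M' → M' ≤ pthRoots p F' →
        (∃ z ∈ M' ⊔ K, ∏ k ∈ Finset.range p, (σ ^ k) z = b) → SplitsOver A d M') ∧
      (SplitsOver A d (pthRoots p F') →
        ∃ z ∈ pthRoots p F' ⊔ K, ∏ k ∈ Finset.range p, (σ ^ k) z = b) := by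
  have hne : Nonempty (Fin d) := ⟨⟨0, hd⟩⟩
  let i₀ : Fin d := ⟨0, hd⟩
  obtain ⟨f, hf, hfN⟩ := hsplit
  obtain ⟨Q, P, hQP, hPQ, -, hPN, hconj⟩ := exists_conj_mem hd hA f
    ((σ : Ω →ₐ[F] Ω).mapMatrix.comp f) hf hfN fun a i j => h.map_mem_sup hM hME (hfN a i j)
  have hfP : ∀ a, f a * P = P * (f a).map σ := fun a => by
    have : (f a).map σ = Q * f a * P := hconj a
    rw [this, ← mul_assoc, ← mul_assoc, hPQ, one_mul]
  have hPu : IsUnit P := ⟨⟨P, Q, hPQ, hQP⟩, rfl⟩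
  have htN := h.twistedPow_mem hM hME hPN
  obtain ⟨b, hb⟩ := exists_scalar_of_commute (z := twistedPow σ P p) hf (by
    rintro _ ⟨a, rfl⟩
    have h1 : (f a).map (σ ^ p) = f a := by
      ext i j
      exact h.pow_apply_of_mem_sup hM hME (hfN a i j)
    rw [twistedPow_intertwine (hfP a), h1])
  have hb' : twistedPow σ P p = b • 1 := by rw [hb, Matrix.smul_one_eq_diagonal]; rfl
  have hbu : IsUnit (twistedPow σ P p) := isUnit_twistedPow hPu p
  have hb0 : b ≠ 0 := by
    rintro rfl
    rw [hb', zero_smul] at hbu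
    exact not_isUnit_zero hbu
  have hbN : b ∈ M ⊔ K := by
    have := htN p i₀ i₀
    rwa [hb', Matrix.smul_apply, Matrix.one_apply_eq, smul_eq_mul, mul_one] at this
  have hbσ : σ b = b := by
    have h1 := twistedPow_succ' σ P p
    have h2 : P.map (σ ^ p) = P := by
      ext i j
      exact h.pow_apply_of_mem_sup hM hME (hPN i j)
    have h3 : (b • (1 : Matrix (Fin d) (Fin d) Ω)).map σ = σ b • 1 := by
      ext i j
      by_cases hij : i = j <;> simp [hij]
    simp only [twistedPow] at h1
    rw [hb', h2, h3, Matrix.mul_smul, mul_one, smul_mul_assoc, one_mul] at h1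
    have h4 : b • (P * Q) = σ b • (P * Q) := by
      rw [← smul_mul_assoc, h1, smul_mul_assoc]
    rw [hPQ] at h4
    have h5 := congrFun (congrFun h4 i₀) i₀
    simpa using h5.symm
  refine ⟨b, h.mem_of_mem_sup_of_map_eq hM hME hbN hbσ, hb0, ?_, ?_⟩
  · rintro M' hMM' hM'E ⟨z, hz, hzb⟩
    have hle : M ⊔ K ≤ M' ⊔ K := sup_le_sup_right hMM' K
    refine h.splitsOver_of_twistedPow_eq_one (hM.trans hMM') hM'E hd hA f hf
      (fun a i j => hle (hfN a i j)) (P := z⁻¹ • P)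
      (fun i j => mul_mem (inv_mem hz) (hle (hPN i j)))
      (fun a => ?_) ?_
    · rw [Matrix.mul_smul, hfP, smul_mul_assoc]
    · rw [twistedPow_smul, hb', smul_smul]
      simp only [map_inv₀, Finset.prod_inv_distrib]
      rw [hzb, inv_mul_cancel₀ hb0, one_smul]
  · rintro ⟨g, hg, hgE⟩
    have hle : M ⊔ K ≤ pthRoots p F' ⊔ K := sup_le_sup_right hME K
    obtain ⟨Q', R, hQR, hRQ, -, hRN, hconj'⟩ := exists_conj_mem hd hA f g hf
      (fun a i j => hle (hfN a i j)) fun a i j =>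
        (le_sup_left : pthRoots p F' ≤ pthRoots p F' ⊔ K) (hgE a i j)
    have hfR : ∀ a, f a * R = R * g a := fun a => by
      rw [hconj', ← mul_assoc, ← mul_assoc, hRQ, one_mul]
    have hgσ : ∀ a, (g a).map σ = g a := fun a => by
      ext i j
      exact h.map_eq_of_mem_pthRoots (hgE a i j)
    obtain ⟨z, hz⟩ := exists_scalar_of_commute (z := P * R.map σ * Q') hf (by
      rintro _ ⟨a, rfl⟩
      have h1 : Q' * f a = g a * Q' := by
        rw [hconj', mul_assoc, hRQ, mul_one]
      symm
      calc f a * (P * R.map σ * Q') = P * ((f a * R).map σ) * Q' := by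
            rw [← mul_assoc, ← mul_assoc, hfP, map_algEquiv_mul, mul_assoc P]
        _ = P * R.map σ * Q' * f a := by
            rw [hfR, map_algEquiv_mul, hgσ, mul_assoc _ Q', h1]
            simp only [mul_assoc])
    have hz' : P * R.map σ = z • R := by
      have h1 := congrArg (· * R) hz
      have h2 : (Matrix.scalar (Fin d)) z = z • (1 : Matrix (Fin d) (Fin d) Ω) := by
        rw [Matrix.smul_one_eq_diagonal]; rfl
      beta_reduce at h1
      rwa [mul_assoc, hQR, mul_one, h2, smul_mul_assoc, one_mul] at h1
    have hentry : ∃ i j, R i j ≠ 0 := by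
      by_contra! hcon
      have : R = 0 := Matrix.ext hcon
      rw [this, mul_zero] at hQR
      exact zero_ne_one hQR
    obtain ⟨i, j, hij⟩ := hentry
    refine ⟨z, ?_, ?_⟩
    · have h1 : z = (P * R.map σ) i j * (R i j)⁻¹ := by
        rw [hz', Matrix.smul_apply, smul_eq_mul, mul_assoc, mul_inv_cancel₀ hij, mul_one]
      rw [h1]
      exact mul_mem (matrix_mul_mem (fun i j => hle (hPN i j))
        (fun i j => h.map_mem_sup (le_pthRoots F') le_rfl (hRN i j)) i j) (inv_mem (hRN i j))
    · have h1 := twistedPow_mul_map hz' p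
      have h2 : R.map (σ ^ p) = R := by
        ext i j
        exact h.pow_apply_of_mem_sup (le_pthRoots F') le_rfl (hRN i j)
      rw [hb', h2, smul_mul_assoc, one_mul] at h1
      have h3 := congrFun (congrFun h1 i) j
      exact (mul_right_cancel₀ hij h3).symm

end Descent

section GaloisStep

open IntermediateField

/-- A cyclic Galois extension `C/B` of degree `p` inside an algebraically closed field gives rise to
a cyclic step. -/
lemma exists_isCyclicStep {F Ω B C : Type*} [Field F] [Field Ω] [Algebra F Ω] [Field B] [Field C]
    [Algebra F B] [Algebra B C] [Algebra B Ω] [Algebra C Ω] [IsScalarTower F B Ω]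
    [IsScalarTower B C Ω] [IsGalois B C] [hcyc : IsCyclic (C ≃ₐ[B] C)] [Normal B Ω] {p : ℕ}
    [hpF : Fact p.Prime] [CharP Ω p] (hp : finrank B C = p) {F' K : IntermediateField F Ω}
    (hF' : ∀ x, x ∈ F' ↔ ∃ y, algebraMap B Ω y = x)
    (hK : ∀ x, x ∈ K ↔ ∃ y, algebraMap C Ω y = x) :
    ∃ σ e, IsCyclicStep p F' K σ e := by
  have : FiniteDimensional B C := FiniteDimensional.of_finrank_pos (by rw [hp]; exact hpF.out.pos)
  have : CharP B p := (RingHom.charP_iff (algebraMap B Ω) (algebraMap B Ω).injective p).2 ‹_›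
  obtain ⟨τ, hτ⟩ := hcyc.exists_generator
  have hord : orderOf τ = p := by
    rw [orderOf_eq_card_of_forall_mem_zpowers hτ, IsGalois.card_aut_eq_finrank, hp]
  let σ : Ω ≃ₐ[F] Ω := (τ.liftNormal Ω).restrictScalars F
  have hσ : ∀ y, σ (algebraMap C Ω y) = algebraMap C Ω (τ y) := fun y =>
    AlgEquiv.liftNormal_commutes τ Ω y
  have hσk : ∀ k y, (σ ^ k) (algebraMap C Ω y) = algebraMap C Ω ((τ ^ k) y) := fun k => by
    induction k with
    | zero => exact fun y => rfl
    | succ k ih =>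
      intro y
      rw [pow_succ, AlgEquiv.mul_apply, hσ, ih, pow_succ, AlgEquiv.mul_apply]
  let v : Basis (Fin p) B C := (finBasis B C).reindex (finCongr hp)
  have hrepr : ∀ w : Fin p → C, Submodule.span B (Set.range w) = ⊤ → ∀ x ∈ K,
      ∃ y : Fin p → Ω, (∀ k, y k ∈ F') ∧ x = ∑ k, y k * algebraMap C Ω (w k) := by
    intro w hw x hx
    obtain ⟨x, rfl⟩ := (hK x).1 hx
    have hx' : x ∈ Submodule.span B (Set.range w) := by rw [hw]; trivial
    obtain ⟨c, rfl⟩ := (Submodule.mem_span_range_iff_exists_fun B).1 hx'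
    refine ⟨fun k => algebraMap B Ω (c k), fun k => (hF' _).2 ⟨_, rfl⟩, ?_⟩
    rw [map_sum]
    refine Finset.sum_congr rfl fun k _ => ?_
    rw [Algebra.smul_def, map_mul, ← IsScalarTower.algebraMap_apply]
  refine ⟨σ, fun k => algebraMap C Ω (v k), ?_, ?_, ?_, ?_, ?_, ?_, ?_, ?_, ?_⟩
  · intro x hx
    obtain ⟨y, rfl⟩ := (hF' x).1 hx
    exact (hK _).2 ⟨algebraMap B C y, (IsScalarTower.algebraMap_apply B C Ω y).symm⟩
  · intro x hx
    obtain ⟨y, rfl⟩ := (hF' x).1 hx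
    exact (τ.liftNormal Ω).commutes y
  · intro x hx
    obtain ⟨y, rfl⟩ := (hK x).1 hx
    exact (hK _).2 ⟨_, (hσ y).symm⟩
  · intro x hx
    obtain ⟨y, rfl⟩ := (hK x).1 hx
    rw [hσk, ← hord, pow_orderOf_eq_one, AlgEquiv.one_apply]
  · intro x hx hfix
    obtain ⟨y, rfl⟩ := (hK x).1 hx
    rw [hσ] at hfix
    have hy : τ y = y := (algebraMap C Ω).injective hfix
    have hbot : y ∈ (⊥ : IntermediateField B C) := by
      rw [IsGalois.mem_bot_iff_fixed]
      intro g
      have hg := hτ g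
      have hsub : Subgroup.zpowers τ ≤ MulAction.stabilizer (C ≃ₐ[B] C) y := by
        rw [Subgroup.zpowers_le]
        exact hy
      exact hsub hg
    obtain ⟨c, rfl⟩ := mem_bot.1 hbot
    exact (hF' _).2 ⟨c, IsScalarTower.algebraMap_apply B C Ω c⟩
  · exact fun k => (hK _).2 ⟨_, rfl⟩
  · exact hrepr v v.span_eq
  · intro x hx
    have hpow := Field.span_map_pow_expChar_pow_eq_top_of_isSeparable (F := B) (E := C) p 1
      v.span_eq
    simp only [pow_one] at hpow
    simpa only [map_pow] using hrepr _ hpow x hx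
  · intro c hc k hk
    let m : Fin p → (C →* Ω) := fun k =>
      ((algebraMap C Ω : C →+* Ω) : C →* Ω).comp ((τ ^ (k : ℕ) : C ≃ₐ[B] C) : C →* C)
    have hm : Function.Injective m := by
      intro k l hkl
      have h1 : τ ^ (k : ℕ) = τ ^ (l : ℕ) := by
        ext x
        exact (algebraMap C Ω).injective (DFunLike.congr_fun hkl x)
      exact Fin.ext (pow_injOn_Iio_orderOf (by rw [hord]; exact k.2) (by rw [hord]; exact l.2) h1)
    have hli := (linearIndependent_monoidHom C Ω).comp m hm
    rw [Fintype.linearIndependent_iff] at hli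
    refine hli (fun k => c k) ?_ ⟨k, hk⟩
    ext x
    have := hc _ ((hK _).2 ⟨x, rfl⟩)
    simp only [hσk] at this
    rw [← Fin.sum_univ_eq_sum_range (fun k => c k * algebraMap C Ω ((τ ^ k) x)) p] at this
    simpa [m] using this

end GaloisStep

section RootSplitting

open IntermediateField

variable {F Ω : Type*} [Field F] [Field Ω] [Algebra F Ω]

/-- `A` splits over an extension of `F'` generated by at most `m` elements whose `p`-th powers are
in `F'`. -/
def SplitsOverRoots (p : ℕ) (A : Type*) [Ring A] [Algebra F A] (d : ℕ)
    (F' : IntermediateField F Ω) (m : ℕ) : Prop :=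
  ∃ s : Finset Ω, s.card ≤ m ∧ (∀ x ∈ s, x ^ p ∈ F') ∧
    SplitsOver A d (F' ⊔ adjoin F (s : Set Ω))

variable {A : Type*} [Ring A] [Algebra F A] {d p : ℕ} [hpF : Fact p.Prime] [CharP Ω p]
  [Algebra.IsAlgebraic F Ω] [IsAlgClosed Ω] {F' K : IntermediateField F Ω} {σ : Ω ≃ₐ[F] Ω}
  {e : Fin p → Ω}

omit [Algebra.IsAlgebraic F Ω] [IsAlgClosed Ω] in
lemma sup_adjoin_le_pthRoots {s : Set Ω} (hs : ∀ x ∈ s, x ^ p ∈ F') :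
    F' ⊔ adjoin F s ≤ pthRoots p F' :=
  sup_le (le_pthRoots F') (adjoin_le_iff.2 hs)

lemma IsCyclicStep.splitsOverRoots_one (h : IsCyclicStep p F' K σ e) (hd : 0 < d)
    (hA : finrank F A = d ^ 2) (hK : SplitsOver A d K) : SplitsOverRoots p A d F' 1 := by
  obtain ⟨b, hb, -, hcrit, -⟩ := h.exists_norm_criterion le_rfl (le_pthRoots F') hd hA
    (by rwa [sup_eq_right.2 h.le])
  obtain ⟨z, hz⟩ := IsAlgClosed.exists_pow_nat_eq b hpF.out.pos
  have hzF : z ^ p ∈ F' := hz ▸ hb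
  have hs : ∀ x ∈ (({z} : Finset Ω) : Set Ω), x ^ p ∈ F' := by simpa using hzF
  refine ⟨{z}, by simp, hs, hcrit _ le_sup_left (sup_adjoin_le_pthRoots hs) ⟨z, ?_, ?_⟩⟩
  · refine (le_sup_left : _ ≤ _ ⊔ K) ((le_sup_right : _ ≤ F' ⊔ _) (subset_adjoin F _ ?_))
    simp
  · have hσz : ∀ k, (σ ^ k) z = z := pow_apply_of_map_eq (h.map_eq_of_mem_pthRoots hzF)
    simp only [hσz, Finset.prod_const, Finset.card_range, hz]

lemma IsCyclicStep.splitsOverRoots_step (h : IsCyclicStep p F' K σ e) (hd : 0 < d)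
    (hA : finrank F A = d ^ 2) (hE : SplitsOver A d (pthRoots p F')) {m : ℕ}
    (hK : SplitsOverRoots p A d K m) : SplitsOverRoots p A d F' (p * (m + 1) - 1) := by
  classical
  obtain ⟨s, hsm, hs, hsplit⟩ := hK
  have hroots : ∀ x : Ω, ∃ r : Fin p → Ω, x ∈ s → (∀ k, r k ^ p ∈ F') ∧ x = ∑ k, r k * e k := by
    intro x
    by_cases hx : x ∈ s
    · obtain ⟨y, hy, hxy⟩ := h.exists_repr_pow _ (hs x hx)
      choose r hr using fun k => IsAlgClosed.exists_pow_nat_eq (y k) hpF.out.pos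
      refine ⟨r, fun _ => ⟨fun k => hr k ▸ hy k, frobenius_inj Ω p ?_⟩⟩
      rw [map_sum]
      simp only [map_mul, frobenius_def, hr, hxy]
    · exact ⟨0, fun hx' => absurd hx' hx⟩
  choose r hr using hroots
  let s₁ : Finset Ω := (s ×ˢ (Finset.univ : Finset (Fin p))).image fun q => r q.1 q.2
  have hs₁m : s₁.card ≤ m * p := by
    refine Finset.card_image_le.trans ?_
    rw [Finset.card_product, Finset.card_univ, Fintype.card_fin]
    exact Nat.mul_le_mul_right p hsm
  have hs₁ : ∀ x ∈ s₁, x ^ p ∈ F' := by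
    intro x hx
    obtain ⟨q, hq, rfl⟩ := Finset.mem_image.1 hx
    exact (hr q.1 (Finset.mem_product.1 hq).1).1 q.2
  set M := F' ⊔ adjoin F (s₁ : Set Ω)
  have hM : F' ≤ M := le_sup_left
  have hME : M ≤ pthRoots p F' := sup_adjoin_le_pthRoots hs₁
  have hle : K ⊔ adjoin F (s : Set Ω) ≤ M ⊔ K := by
    refine sup_le le_sup_right (adjoin_le_iff.2 fun x hx => ?_)
    refine (h.mem_sup_iff hM).2 ⟨r x, fun k => ?_, (hr x hx).2⟩
    refine (le_sup_right : _ ≤ F' ⊔ _) (subset_adjoin F _ ?_)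
    exact Finset.mem_coe.2 (Finset.mem_image.2
      ⟨(x, k), Finset.mem_product.2 ⟨hx, Finset.mem_univ k⟩, rfl⟩)
  obtain ⟨b, hbM, hb0, hcrit, hconv⟩ := h.exists_norm_criterion hM hME hd hA (hsplit.mono hle)
  obtain ⟨z, hz, hzb⟩ := hconv hE
  obtain ⟨s₂, hs₂m, hs₂, hmem⟩ := h.exists_norm_mem_sup_adjoin hb0 hz hzb
  have hs : ∀ x ∈ ((s₁ ∪ s₂ : Finset Ω) : Set Ω), x ^ p ∈ F' := by
    intro x hx
    rcases Finset.mem_union.1 (Finset.mem_coe.1 hx) with hx | hx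
    · exact hs₁ x hx
    · exact hs₂ x hx
  have hMM' : M ≤ F' ⊔ adjoin F ((s₁ ∪ s₂ : Finset Ω) : Set Ω) :=
    sup_le_sup_left (adjoin.mono F _ _ (by simp)) F'
  refine ⟨s₁ ∪ s₂, ?_, hs, hcrit _ hMM' (sup_adjoin_le_pthRoots hs) ⟨z, ?_, hzb⟩⟩
  · refine (Finset.card_union_le _ _).trans ?_
    have := hpF.out.pos
    have h1 : p * (m + 1) = m * p + p := by ring
    omega
  · refine hmem _ (hM.trans hMM') (sup_adjoin_le_pthRoots hs) (hMM' hbM) fun x hx => ?_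
    refine (le_sup_right : _ ≤ F' ⊔ _) (subset_adjoin F _ ?_)
    simp [Finset.mem_coe.1 hx]

end RootSplitting

section Tower

open IntermediateField

lemma normal_of_isAlgClosed (F : Type*) {B Ω : Type*} [Field F] [Field B] [Field Ω] [Algebra F B]
    [Algebra F Ω] [Algebra B Ω] [IsScalarTower F B Ω] [Algebra.IsAlgebraic F Ω] [IsAlgClosed Ω] :
    Normal B Ω :=
  have : IsAlgClosure B Ω := ⟨‹_›, Algebra.IsAlgebraic.tower_top (K := F) B⟩
  inferInstance

/-- A `p`-extension of degree `p ^ n` inside an algebraically closed field is a chain of `n` cyclic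
steps. -/
lemma IsPExtension.exists_chain {p n : ℕ} {F L : Type} [Field F] [Field L] [Algebra F L]
    (hL : IsPExtension p F L) (hfin : finrank F L = p ^ n) {Ω : Type*} [Field Ω] [Algebra F Ω]
    [Algebra L Ω] [IsScalarTower F L Ω] [Algebra.IsAlgebraic F Ω] [IsAlgClosed Ω]
    [hpF : Fact p.Prime] [CharP Ω p] :
    ∃ T : ℕ → IntermediateField F Ω, T 0 = ⊥ ∧
      T n = (IsScalarTower.toAlgHom F L Ω).fieldRange ∧
      ∀ i < n, ∃ σ e, IsCyclicStep p (T i) (T (i + 1)) σ e := by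
  obtain ⟨N, T, hT0, hTN, hstep⟩ := hL
  have hdeg : ∀ i (hi : i < N + 1), finrank F (T ⟨i, hi⟩) = p ^ i := by
    intro i
    induction i with
    | zero =>
      intro hi
      have : T ⟨0, hi⟩ = ⊥ := hT0
      rw [this, IntermediateField.finrank_bot, pow_zero]
    | succ i ih =>
      intro hi
      obtain ⟨hle, -, -, hp⟩ := hstep ⟨i, by omega⟩
      have h1 := finrank_mul_finrank F (T (Fin.castSucc ⟨i, _⟩)) (extendScalars hle)
      rw [hp] at h1
      have h2 : finrank F (T (Fin.castSucc ⟨i, by omega⟩)) = p ^ i := ih _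
      rw [h2, ← pow_succ] at h1
      exact h1.symm
  obtain rfl : N = n := by
    have h1 := hdeg N (by omega)
    have h2 : T ⟨N, by omega⟩ = ⊤ := hTN
    rw [h2, finrank_top', hfin] at h1
    exact (Nat.pow_right_injective hpF.out.two_le h1).symm
  let φ : L →ₐ[F] Ω := IsScalarTower.toAlgHom F L Ω
  refine ⟨fun i => if hi : i < N + 1 then (T ⟨i, hi⟩).map φ else ⊥, ?_, ?_, ?_⟩
  · have h0 : T ⟨0, by omega⟩ = ⊥ := hT0
    simp only [Nat.succ_pos, dite_true, h0]
    exact IntermediateField.map_bot φ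
  · have h2 : T ⟨N, by omega⟩ = ⊤ := hTN
    simp only [Nat.lt_succ_self, dite_true, h2]
    exact (AlgHom.fieldRange_eq_map φ).symm
  · intro i hi
    obtain ⟨hle, hgal, hcyc, hp⟩ := hstep ⟨i, hi⟩
    have : Normal (T (Fin.castSucc ⟨i, hi⟩)) Ω := normal_of_isAlgClosed F
    simp only [show i < N + 1 by omega, show i + 1 < N + 1 by omega, dite_true]
    refine exists_isCyclicStep (B := T (Fin.castSucc ⟨i, hi⟩)) (C := extendScalars hle) hp ?_ ?_
    · intro x
      exact ⟨fun ⟨y, hy, hyx⟩ => ⟨⟨y, hy⟩, hyx⟩, fun ⟨y, hyx⟩ => ⟨y.1, y.2, hyx⟩⟩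
    · intro x
      exact ⟨fun ⟨y, hy, hyx⟩ => ⟨⟨y, hy⟩, hyx⟩, fun ⟨y, hyx⟩ => ⟨y.1, y.2, hyx⟩⟩

variable {F Ω : Type*} [Field F] [Field Ω] [Algebra F Ω] [Algebra.IsAlgebraic F Ω]
  {p n : ℕ} [hpF : Fact p.Prime] [CharP Ω p] {T : ℕ → IntermediateField F Ω}

omit [Algebra.IsAlgebraic F Ω] in
lemma mem_bot_of_pow_mem_bot_of_chain (h0 : T 0 = ⊥)
    (hT : ∀ i < n, ∃ σ e, IsCyclicStep p (T i) (T (i + 1)) σ e) {c : Ω} (hc : c ∈ T n)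
    (hcp : c ^ p ∈ (⊥ : IntermediateField F Ω)) : c ∈ (⊥ : IntermediateField F Ω) := by
  induction n with
  | zero => rwa [← h0]
  | succ n ih =>
    obtain ⟨σ, e, h⟩ := hT n (by omega)
    exact ih (fun i hi => hT i (by omega))
      (h.mem_of_map_eq c hc (h.map_eq_of_mem_pthRoots (mem_pthRoots.2 (bot_le (a := T n) hcp))))

lemma splitsOverRoots_bot_of_chain [IsAlgClosed Ω] {A : Type*} [Ring A] [Algebra F A] {d : ℕ}
    (hd : 0 < d) (hA : finrank F A = d ^ 2) (h0 : T 0 = ⊥) (hn : 0 < n)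
    (hT : ∀ i < n, ∃ σ e, IsCyclicStep p (T i) (T (i + 1)) σ e) (hTn : SplitsOver A d (T n))
    (hE : SplitsOver A d (pthRoots p (⊥ : IntermediateField F Ω))) :
    SplitsOverRoots p A d (⊥ : IntermediateField F Ω) (2 * p ^ (n - 1) - 1) := by
  have key : ∀ i j, j + i + 1 = n → SplitsOverRoots p A d (T j) (2 * p ^ i - 1) := by
    intro i
    induction i with
    | zero =>
      intro j hj
      obtain ⟨σ, e, h⟩ := hT j (by omega)
      obtain rfl : j + 1 = n := by omega
      exact h.splitsOverRoots_one hd hA hTn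
    | succ i ih =>
      intro j hj
      obtain ⟨σ, e, h⟩ := hT j (by omega)
      have hE' : SplitsOver A d (pthRoots p (T j)) := hE.mono fun x hx => bot_le (a := T j) hx
      have := h.splitsOverRoots_step hd hA hE' (ih (j + 1) (by omega))
      have hpos : 0 < p ^ i := pow_pos hpF.out.pos i
      rwa [show p * (2 * p ^ i - 1 + 1) = 2 * p ^ (i + 1) by
        rw [Nat.sub_add_cancel (by omega)]; ring] at this
  rw [← h0]
  exact key (n - 1) 0 (by omega)

end Tower

section Orbits

variable {ι α : Type*} {p : ℕ}

lemma eq_const_of_comp_pow_eq {π : Equiv.Perm ι} (hp : p.Prime) (hπ : π ^ p = 1)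
    (htrans : ∀ i j, ∃ k : ℕ, (π ^ k) i = j) [Nonempty ι] {x : ι → α} {m : ℕ} (hm0 : 0 < m)
    (hmp : m < p) (hx : x ∘ ⇑(π ^ m) = x) : ∃ a, x = Function.const ι a := by
  have hpow : ∀ k : ℕ, x ∘ ⇑((π ^ m) ^ k) = x := by
    intro k
    induction k with
    | zero => rfl
    | succ k ih =>
      rw [pow_succ]
      calc x ∘ ⇑((π ^ m) ^ k * π ^ m) = (x ∘ ⇑((π ^ m) ^ k)) ∘ ⇑(π ^ m) := rfl
        _ = x := by rw [ih, hx]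
  have hcop : m.Coprime p :=
    ((Nat.Prime.coprime_iff_not_dvd hp).2 (Nat.not_dvd_of_pos_of_lt hm0 hmp)).symm
  obtain ⟨k, -, hk⟩ := Nat.exists_mul_mod_eq_one_of_coprime hcop hp.one_lt
  have hπk : (π ^ m) ^ k = π := by
    rw [← pow_mul, ← Nat.mod_add_div (m * k) p, hk, pow_add, pow_mul, hπ, one_pow, mul_one, pow_one]
  have h1 : ∀ l : ℕ, x ∘ ⇑(π ^ l) = x := by
    intro l
    have := hpow (k * l)
    rwa [pow_mul, hπk] at this
  let i₀ : ι := Classical.arbitrary ι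
  refine ⟨x i₀, funext fun j => ?_⟩
  obtain ⟨l, rfl⟩ := htrans i₀ j
  exact congrFun (h1 l) i₀

/-- A weight function which sums to `1` over each free orbit of the rotation action on functions. -/
lemma exists_orbit_weight [Finite ι] [Finite α] [Nonempty ι] {π : Equiv.Perm ι} (hp : p.Prime)
    (hπ : π ^ p = 1) (htrans : ∀ i j, ∃ k : ℕ, (π ^ k) i = j) :
    ∃ χ : (ι → α) → ℕ, ∀ x, (¬ ∃ a, x = Function.const ι a) →
      ∑ k ∈ Finset.range p, χ (x ∘ ⇑(π ^ k)) = 1 := by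
  classical
  have := Fintype.ofFinite ι
  have := Fintype.ofFinite α
  let en : (ι → α) → ℕ := fun x => Fintype.equivFin (ι → α) x
  have hen : Function.Injective en := Fin.val_injective.comp (Fintype.equivFin _).injective
  refine ⟨fun x => if ∀ k : ℕ, en x ≤ en (x ∘ ⇑(π ^ k)) then 1 else 0, fun x hx => ?_⟩
  obtain ⟨k₀, hk₀, hmin⟩ := Finset.exists_min_image (Finset.range p) (fun k => en (x ∘ ⇑(π ^ k)))
    ⟨0, Finset.mem_range.2 hp.pos⟩
  have hmod : ∀ k : ℕ, π ^ k = π ^ (k % p) := fun k => by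
    conv_lhs => rw [← Nat.mod_add_div k p, pow_add, pow_mul, hπ, one_pow, mul_one]
  have hmin' : ∀ k : ℕ, en (x ∘ ⇑(π ^ k₀)) ≤ en (x ∘ ⇑(π ^ k)) := fun k => by
    rw [hmod k]
    exact hmin _ (Finset.mem_range.2 (Nat.mod_lt _ hp.pos))
  have hcomp : ∀ k l : ℕ, (x ∘ ⇑(π ^ k)) ∘ ⇑(π ^ l) = x ∘ ⇑(π ^ (k + l)) := fun k l => by
    rw [pow_add]; rfl
  have hinj : ∀ k l, k < l → l < p → x ∘ ⇑(π ^ k) ≠ x ∘ ⇑(π ^ l) := by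
    intro k l hkl hl heq
    apply hx
    refine eq_const_of_comp_pow_eq hp hπ htrans (m := l - k) (by omega) (by omega) ?_
    have h1 := congrArg (fun y => y ∘ ⇑(π ^ (p - k))) heq
    simp only [hcomp] at h1
    rw [show k + (p - k) = p by omega, show l + (p - k) = p + (l - k) by omega, pow_add, hπ,
      one_mul] at h1
    exact h1.symm
  rw [Finset.sum_eq_single k₀]
  · refine if_pos fun k => ?_
    rw [hcomp]
    exact hmin' _
  · intro k hk hne
    refine if_neg fun hall => ?_
    have h1 := hall (p - k + k₀)
    rw [Finset.mem_range] at hk hk₀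
    rw [hcomp, show k + (p - k + k₀) = p + k₀ by omega, pow_add, hπ, one_mul] at h1
    have h2 := hen (le_antisymm h1 (hmin' k))
    rcases lt_or_gt_of_ne hne with hlt | hlt
    · exact hinj _ _ hlt hk₀ h2
    · exact hinj _ _ hlt hk h2.symm
  · exact fun h => absurd hk₀ h

variable [Fintype ι] [DecidableEq ι] [Fintype α] [Nonempty ι] {L : Type*} [CommRing L] [CharP L p]
  {π : Equiv.Perm ι}

/-- A rotation invariant function has the same sum as its restriction to the constants, in
characteristic `p`. -/
lemma sum_eq_sum_const_of_comp_eq (hp : p.Prime) (hπ : π ^ p = 1)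
    (htrans : ∀ i j, ∃ k : ℕ, (π ^ k) i = j) (Φ : (ι → α) → L) (hΦ : ∀ x, Φ (x ∘ ⇑π) = Φ x) :
    ∑ x, Φ x = ∑ a, Φ (Function.const ι a) := by
  classical
  obtain ⟨χ, hχ⟩ := exists_orbit_weight (α := α) hp hπ htrans
  have hΦk : ∀ k x, Φ (x ∘ ⇑(π ^ k)) = Φ x := by
    intro k
    induction k with
    | zero => exact fun x => rfl
    | succ k ih =>
      intro x
      rw [pow_succ]
      exact (hΦ (x ∘ ⇑(π ^ k))).trans (ih x)
  let C : Finset (ι → α) := Finset.univ.map ⟨Function.const ι, Function.const_injective⟩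
  have hC : ∀ x, x ∉ C → ¬ ∃ a, x = Function.const ι a := by
    rintro x hx ⟨a, rfl⟩
    exact hx (Finset.mem_map_of_mem _ (Finset.mem_univ a))
  have hrot : ∀ (k : ℕ) x, x ∘ ⇑(π ^ k) ∈ C ↔ x ∈ C := by
    intro k x
    constructor
    · intro hx
      obtain ⟨a, -, ha⟩ := Finset.mem_map.1 hx
      have : x = Function.const ι a := by
        funext i
        have := congrFun ha ((π ^ k).symm i)
        simpa using this.symm
      rw [this]
      exact Finset.mem_map_of_mem _ (Finset.mem_univ a)
    · intro hx
      obtain ⟨a, -, rfl⟩ := Finset.mem_map.1 hx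
      exact hx
  rw [← Finset.sum_add_sum_compl C, Finset.sum_map]
  have hcompl : ∑ x ∈ Cᶜ, Φ x = 0 := by
    calc ∑ x ∈ Cᶜ, Φ x
        = ∑ x ∈ Cᶜ, ∑ k ∈ Finset.range p, Φ (x ∘ ⇑(π ^ k)) * χ (x ∘ ⇑(π ^ k)) := by
          refine Finset.sum_congr rfl fun x hx => ?_
          simp only [hΦk]
          rw [← Finset.mul_sum, ← Nat.cast_sum, hχ x (hC x (Finset.mem_compl.1 hx)), Nat.cast_one,
            mul_one]
      _ = ∑ k ∈ Finset.range p, ∑ x ∈ Cᶜ, Φ x * χ x := by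
          rw [Finset.sum_comm]
          refine Finset.sum_congr rfl fun k _ => ?_
          refine Finset.sum_equiv ((π ^ k).symm.arrowCongr (Equiv.refl α)) ?_ ?_
          · intro x
            simp only [Finset.mem_compl]
            exact not_congr (hrot k x).symm
          · intro x _
            rfl
      _ = 0 := by
          rw [Finset.sum_const, Finset.card_range, nsmul_eq_mul, CharP.cast_eq_zero, zero_mul]
  rw [hcompl, add_zero]
  rfl

omit [Fintype ι] [DecidableEq ι] [Fintype α] [CharP L p] in
/-- A rotation invariant function vanishing on constants is a norm. -/
lemma exists_sum_comp_pow_eq [Finite ι] [Finite α] (hp : p.Prime) (hπ : π ^ p = 1)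
    (htrans : ∀ i j, ∃ k : ℕ, (π ^ k) i = j) (v : (ι → α) → L) (hv : ∀ x, v (x ∘ ⇑π) = v x)
    (hv0 : ∀ a, v (Function.const ι a) = 0) :
    ∃ u : (ι → α) → L, ∀ x, v x = ∑ k ∈ Finset.range p, u (x ∘ ⇑(π ^ k)) := by
  obtain ⟨χ, hχ⟩ := exists_orbit_weight (α := α) hp hπ htrans
  have hvk : ∀ k x, v (x ∘ ⇑(π ^ k)) = v x := by
    intro k
    induction k with
    | zero => exact fun x => rfl
    | succ k ih =>
      intro x
      rw [pow_succ]
      exact (hv (x ∘ ⇑(π ^ k))).trans (ih x)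
  refine ⟨fun x => v x * χ x, fun x => ?_⟩
  simp only [hvk]
  rw [← Finset.mul_sum, ← Nat.cast_sum]
  by_cases hx : ∃ a, x = Function.const ι a
  · obtain ⟨a, rfl⟩ := hx
    rw [hv0, zero_mul]
  · rw [hχ x hx, Nat.cast_one, mul_one]

end Orbits

section Descent

open scoped Matrix

/-- An `F`-subspace of `V` which spans `V` over `L`, and whose `F`-independent families are
`L`-independent, is the `F`-span of an `L`-basis of `V`. -/
lemma exists_basis_of_linearIndependent_of_span_eq_top {F L V α : Type*} [Field F] [Field L]
    [Algebra F L] [AddCommGroup V] [Module F V] [Module L V] [IsScalarTower F L V]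
    (b₀ : Basis α L V) (W : Submodule F V) (hspan : Submodule.span L (W : Set V) = ⊤)
    (hli : ∀ (J : Set W) (w : J → V), (∀ i, w i ∈ W) → LinearIndependent F w →
      LinearIndependent L w) :
    ∃ b : Basis α L V, W = Submodule.span F (Set.range b) := by
  let c := Basis.ofVectorSpace F W
  have hc : Submodule.span F (Set.range (fun i => (c i : V))) = W := by
    have h1 := congrArg (Submodule.map W.subtype) c.span_eq
    rw [Submodule.map_span, Submodule.map_top, Submodule.range_subtype, ← Set.range_comp] at h1
    exact h1
  have hcL : LinearIndependent L (fun i => (c i : V)) :=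
    hli _ _ (fun i => (c i).2) (c.linearIndependent.map' W.subtype W.ker_subtype)
  have hcs : ⊤ ≤ Submodule.span L (Set.range (fun i => (c i : V))) := by
    rw [← hspan, Submodule.span_le]
    intro x hx
    rw [← hc] at hx
    exact Submodule.span_le_restrictScalars F L _ hx
  let b₁ := Basis.mk hcL hcs
  refine ⟨b₁.reindex (b₁.indexEquiv b₀), ?_⟩
  rw [Basis.range_reindex, Basis.coe_mk, hc]

variable {F L ι α n : Type*} [Field F] [Field L] [Algebra F L] [Fintype ι] [DecidableEq ι]
  [Nonempty ι] [Fintype α] [DecidableEq α] [Fintype n] [DecidableEq n] {p : ℕ}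
  {π : Equiv.Perm ι} {s : Matrix n n F} {Q : Matrix (ι → α) n L} {R : Matrix n (ι → α) L}
  {P : Matrix (ι → α) (ι → α) L}

omit [DecidableEq n] in
lemma comp_map_algebraMap_mulVec (s : Matrix n n F) (θ : L →ₗ[F] F) (y : n → L) :
    θ ∘ (s.map (algebraMap F L) *ᵥ y) = s *ᵥ (θ ∘ y) := by
  funext i
  simp only [Function.comp_apply, Matrix.mulVec, dotProduct, Matrix.map_apply, map_sum,
    ← Algebra.smul_def, map_smul, smul_eq_mul]

omit [Nonempty ι] in
lemma pow_mulVec_apply_of_mulVec_apply (hP : ∀ v x, (P *ᵥ v) x = v (x ∘ ⇑π)) (k : ℕ)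
    (v : (ι → α) → L) (x : ι → α) : (P ^ k *ᵥ v) x = v (x ∘ ⇑(π ^ k)) := by
  induction k generalizing v with
  | zero => simp
  | succ k ih =>
    rw [pow_succ, ← Matrix.mulVec_mulVec, ih, hP, pow_succ]
    rfl

/-- The `F`-space of diagonals of the `s`-invariant vectors defined over `F`. -/
def diagonalFixed (s : Matrix n n F) (Q : Matrix (ι → α) n L) : Submodule F (α → L) where
  carrier := {w | ∃ x : n → F, s *ᵥ x = x ∧
    w = (Q *ᵥ (algebraMap F L ∘ x)) ∘ Function.const ι}
  zero_mem' := ⟨0, by simp, by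
    have : algebraMap F L ∘ (0 : n → F) = 0 := by funext i; simp
    rw [this, Matrix.mulVec_zero]; rfl⟩
  add_mem' := by
    rintro _ _ ⟨x, hx, rfl⟩ ⟨y, hy, rfl⟩
    refine ⟨x + y, by rw [Matrix.mulVec_add, hx, hy], ?_⟩
    have : algebraMap F L ∘ (x + y) = algebraMap F L ∘ x + algebraMap F L ∘ y := by
      funext i; simp
    rw [this, Matrix.mulVec_add]; rfl
  smul_mem' := by
    rintro c _ ⟨x, hx, rfl⟩
    refine ⟨c • x, by rw [Matrix.mulVec_smul, hx], ?_⟩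
    have : algebraMap F L ∘ (c • x) = c • (algebraMap F L ∘ x) := by
      funext i; simp [Algebra.smul_def]
    rw [this, Matrix.mulVec_smul]; rfl

lemma comp_const_mulVec_eq_zero [CharP L p] (hp : p.Prime) (hπ : π ^ p = 1)
    (htrans : ∀ i j, ∃ k : ℕ, (π ^ k) i = j) (hP : ∀ v x, (P *ᵥ v) x = v (x ∘ ⇑π))
    (hQR : Q * R = 1) (hRQ : R * Q = 1) (hs : s.map (algebraMap F L) = R * P * Q)
    (y : n → L) (hy : s.map (algebraMap F L) *ᵥ y = y)
    (hy0 : (Q *ᵥ y) ∘ Function.const ι = 0) (θ : L →ₗ[F] F) :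
    (Q *ᵥ (algebraMap F L ∘ θ ∘ y)) ∘ Function.const ι = 0 := by
  set S := s.map (algebraMap F L) with hS
  have hQS : Q * S = P * Q := by
    rw [hs, Matrix.mul_assoc, ← Matrix.mul_assoc Q, hQR, Matrix.one_mul]
  have hQSk : ∀ k, Q * S ^ k = P ^ k * Q := by
    intro k
    induction k with
    | zero => simp
    | succ k ih =>
      rw [pow_succ, ← Matrix.mul_assoc, ih, Matrix.mul_assoc, hQS, ← Matrix.mul_assoc, ← pow_succ]
  have hSk : ∀ k, S ^ k = (s ^ k).map (algebraMap F L) := fun k =>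
    (map_pow (algebraMap F L).mapMatrix s k).symm
  obtain ⟨u, hu⟩ := exists_sum_comp_pow_eq hp hπ htrans (Q *ᵥ y)
    (fun x => by
      rw [← hP (Q *ᵥ y) x, Matrix.mulVec_mulVec, ← hQS, ← Matrix.mulVec_mulVec, hy])
    (fun a => congrFun hy0 a)
  have hu' : Q *ᵥ y = ∑ k ∈ Finset.range p, P ^ k *ᵥ u := by
    funext x
    rw [hu, Finset.sum_apply]
    exact Finset.sum_congr rfl fun k _ => (pow_mulVec_apply_of_mulVec_apply hP k u x).symm
  have hy' : y = ∑ k ∈ Finset.range p, S ^ k *ᵥ (R *ᵥ u) := by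
    have h1 : y = R *ᵥ (Q *ᵥ y) := by rw [Matrix.mulVec_mulVec, hRQ, Matrix.one_mulVec]
    rw [h1, hu', Matrix.mulVec_sum]
    refine Finset.sum_congr rfl fun k _ => ?_
    rw [Matrix.mulVec_mulVec, Matrix.mulVec_mulVec]
    congr 1
    calc R * P ^ k = R * (P ^ k * Q) * R := by
          rw [Matrix.mul_assoc, Matrix.mul_assoc, hQR, Matrix.mul_one]
      _ = S ^ k * R := by rw [← hQSk, ← Matrix.mul_assoc, hRQ, Matrix.one_mul]
  have hθ : algebraMap F L ∘ θ ∘ y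
      = ∑ k ∈ Finset.range p, S ^ k *ᵥ (algebraMap F L ∘ θ ∘ (R *ᵥ u)) := by
    have h1 : θ ∘ y = ∑ k ∈ Finset.range p, s ^ k *ᵥ (θ ∘ (R *ᵥ u)) := by
      simp only [← comp_map_algebraMap_mulVec (L := L), ← hSk]
      conv_lhs => rw [hy']
      funext i
      simp
    rw [h1]
    funext i
    simp only [Function.comp_apply, Finset.sum_apply, map_sum]
    refine Finset.sum_congr rfl fun k _ => ?_
    rw [hSk]
    exact RingHom.map_mulVec (algebraMap F L) (s ^ k) _ i
  rw [hθ, Matrix.mulVec_sum]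
  funext a
  simp only [Function.comp_apply, Finset.sum_apply, Matrix.mulVec_mulVec, hQSk]
  simp only [← Matrix.mulVec_mulVec, pow_mulVec_apply_of_mulVec_apply hP, Function.const_comp]
  rw [Finset.sum_const, Finset.card_range, nsmul_eq_mul, CharP.cast_eq_zero, zero_mul]
  rfl

lemma linearIndependent_of_mem_diagonalFixed [CharP L p] (hp : p.Prime) (hπ : π ^ p = 1)
    (htrans : ∀ i j, ∃ k : ℕ, (π ^ k) i = j) (hP : ∀ v x, (P *ᵥ v) x = v (x ∘ ⇑π))
    (hQR : Q * R = 1) (hRQ : R * Q = 1) (hs : s.map (algebraMap F L) = R * P * Q)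
    {J : Type*} (w : J → α → L) (hw : ∀ i, w i ∈ diagonalFixed s Q)
    (hli : LinearIndependent F w) : LinearIndependent L w := by
  choose x hx hwx using hw
  rw [linearIndependent_iff'] at hli ⊢
  intro t g hg
  let y : n → L := ∑ i ∈ t, g i • (algebraMap F L ∘ x i)
  have hy : s.map (algebraMap F L) *ᵥ y = y := by
    simp only [y, Matrix.mulVec_sum, Matrix.mulVec_smul]
    refine Finset.sum_congr rfl fun i _ => ?_
    congr 1
    conv_rhs => rw [← hx i]
    funext j
    exact (RingHom.map_mulVec (algebraMap F L) s (x i) j).symm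
  have hy0 : (Q *ᵥ y) ∘ Function.const ι = 0 := by
    rw [← hg]
    funext a
    simp [y, Matrix.mulVec_sum, Matrix.mulVec_smul, hwx, Finset.sum_apply]
  intro i hi
  rw [← Module.forall_dual_apply_eq_zero_iff F]
  intro θ
  refine hli t (fun i => θ (g i)) ?_ i hi
  have h := comp_const_mulVec_eq_zero hp hπ htrans hP hQR hRQ hs y hy hy0 θ
  have hθ : algebraMap F L ∘ θ ∘ y = ∑ i ∈ t, θ (g i) • (algebraMap F L ∘ x i) := by
    funext j
    simp only [y, Function.comp_apply, Finset.sum_apply, Pi.smul_apply, map_sum, smul_eq_mul]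
    refine Finset.sum_congr rfl fun i _ => ?_
    rw [mul_comm, ← Algebra.smul_def, map_smul, smul_eq_mul, map_mul, mul_comm, Algebra.smul_def]
  rw [← h, hθ]
  funext a
  simp [Matrix.mulVec_sum, Matrix.mulVec_smul, hwx, Finset.sum_apply]

omit [DecidableEq n] in
lemma span_diagonalFixed_eq_top [FiniteDimensional F L]
    (hP : ∀ v x, (P *ᵥ v) x = v (x ∘ ⇑π))
    (hQR : Q * R = 1) (hs : s.map (algebraMap F L) = R * P * Q) :
    Submodule.span L (diagonalFixed s Q : Set (α → L)) = ⊤ := by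
  classical
  rw [eq_top_iff]
  intro w _
  let i₀ : ι := Classical.arbitrary ι
  let v : (ι → α) → L := fun x => if x ∘ ⇑π = x then w (x i₀) else 0
  have hv : P *ᵥ v = v := by
    funext x
    rw [hP]
    have h1 : (x ∘ ⇑π) ∘ ⇑π = x ∘ ⇑π ↔ x ∘ ⇑π = x := by
      constructor
      · intro h
        funext i
        have := congrFun h (π.symm i)
        simpa using this
      · intro h
        rw [h, h]
    by_cases hx : x ∘ ⇑π = x
    · rw [hx]
    · simp only [v, if_neg hx, if_neg (mt h1.1 hx)]
  let y : n → L := R *ᵥ v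
  have hy : s.map (algebraMap F L) *ᵥ y = y := by
    simp only [y]
    rw [hs, Matrix.mulVec_mulVec, Matrix.mul_assoc, hQR, Matrix.mul_one, ← Matrix.mulVec_mulVec, hv]
  have hQy : (Q *ᵥ y) ∘ Function.const ι = w := by
    simp only [y]
    rw [Matrix.mulVec_mulVec, hQR, Matrix.one_mulVec]
    funext a
    simp [v]
  let b := finBasis F L
  have hyb : y = ∑ k, b k • (algebraMap F L ∘ b.coord k ∘ y) := by
    funext j
    conv_lhs => rw [← b.sum_repr (y j)]
    simp [Finset.sum_apply, Algebra.smul_def, mul_comm]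
  rw [← hQy, hyb]
  have : (Q *ᵥ ∑ k, b k • (algebraMap F L ∘ b.coord k ∘ y)) ∘ Function.const ι
      = ∑ k, b k • ((Q *ᵥ (algebraMap F L ∘ b.coord k ∘ y)) ∘ Function.const ι) := by
    funext a
    simp [Matrix.mulVec_sum, Matrix.mulVec_smul, Finset.sum_apply]
  rw [this]
  refine Submodule.sum_mem _ fun k _ => Submodule.smul_mem _ _ (Submodule.subset_span ?_)
  exact ⟨b.coord k ∘ y, by rw [← comp_map_algebraMap_mulVec, hy], rfl⟩

end Descent

section TensorPower

open scoped Matrix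

/-- There is a transitive permutation of `Fin p` whose `p`-th power is trivial. -/
lemma exists_perm_fin_pow_eq_one {p : ℕ} (hp : p.Prime) :
    ∃ π : Equiv.Perm (Fin p), π ^ p = 1 ∧ ∀ i j, ∃ k : ℕ, (π ^ k) i = j := by
  obtain ⟨m, rfl⟩ := Nat.exists_eq_add_of_le' hp.two_le
  refine ⟨finRotate (m + 2), ?_, fun i j => ?_⟩
  · have h := (isCycle_finRotate (n := m)).orderOf
    rw [support_finRotate, Finset.card_univ, Fintype.card_fin] at h
    have h1 := pow_orderOf_eq_one (finRotate (m + 2))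
    rwa [h] at h1
  · have h : ∀ i, finRotate (m + 2) i ≠ i := fun i =>
      Equiv.Perm.mem_support.1 (by rw [support_finRotate]; exact Finset.mem_univ i)
    exact isCycle_finRotate.exists_pow_eq (h i) (h j)

lemma span_range_map_algebraMap_eq_top {F L T n : Type*} [Field F] [Field L] [Algebra F L] [Ring T]
    [Algebra F T] [Fintype n] [DecidableEq n] (h : T ≃ₐ[F] Matrix n n F) :
    Submodule.span L (Set.range (((Algebra.ofId F L).mapMatrix).comp h.toAlgHom)) =
      (⊤ : Submodule L (Matrix n n L)) := by
  rw [eq_top_iff]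
  intro M _
  rw [Matrix.matrix_eq_sum_single M]
  refine Submodule.sum_mem _ fun i _ => Submodule.sum_mem _ fun j _ => ?_
  have : Matrix.single i j (M i j) =
      M i j • ((Algebra.ofId F L).mapMatrix).comp h.toAlgHom (h.symm (Matrix.single i j 1)) := by
    simp [Matrix.map_single, Matrix.smul_single]
  rw [this]
  exact Submodule.smul_mem _ _ (Submodule.subset_span ⟨_, rfl⟩)

variable {F L A ι α : Type*} [Field F] [Field L] [Algebra F L] [Ring A] [Algebra F A] [Fintype ι]
  [DecidableEq ι] [Fintype α] [DecidableEq α]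

/-- The tensor power of a matrix representation. -/
noncomputable def tensorPowerRep (ι : Type*) [Fintype ι] [DecidableEq ι]
    (f : A →ₐ[F] Matrix α α L) :
    (⨂[F] _ : ι, A) →ₐ[F] Matrix (ι → α) (ι → α) L :=
  let e (x y : ι → α) : MultilinearMap F (fun _ : ι => A) L :=
    (MultilinearMap.mkPiAlgebra F ι L).compLinearMap
      fun i => Matrix.entryLinearMap F L (x i) (y i) ∘ₗ f.toLinearMap
  PiTensorProduct.liftAlgHom
    { toFun := fun a => Matrix.of fun x y => e x y a
      map_update_add' := by
        intro hdec a i b c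
        ext x y
        exact (e x y).map_update_add a i b c
      map_update_smul' := by
        intro hdec a i b c
        ext x y
        exact (e x y).map_update_smul a i b c }
    (by
      ext x y
      simp only [MultilinearMap.coe_mk, Matrix.of_apply, e]
      simp [Matrix.one_apply, Finset.prod_ite_zero, funext_iff])
    (by
      intro a b
      ext x y
      simp only [MultilinearMap.coe_mk, Matrix.of_apply, e, Matrix.mul_apply]
      simp [Matrix.mul_apply, Finset.prod_univ_sum, Finset.prod_mul_distrib])

lemma tensorPowerRep_tprod_apply (f : A →ₐ[F] Matrix α α L) (a : ι → A) (x y : ι → α) :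
    tensorPowerRep ι f (PiTensorProduct.tprod F a) x y = ∏ i, f (a i) (x i) (y i) := by
  simp [tensorPowerRep]

/-- Permutation of the factors of a tensor power. -/
noncomputable def tensorPowerPerm (F A : Type*) [Field F] [Ring A] [Algebra F A]
    (π : Equiv.Perm ι) :
    (⨂[F] _ : ι, A) →ₐ[F] ⨂[F] _ : ι, A :=
  PiTensorProduct.liftAlgHom ((PiTensorProduct.tprod F).domDomCongr π.symm)
    (by simp [PiTensorProduct.one_def]; rfl)
    (by intro a b; simp; rfl)

omit [Fintype ι] [DecidableEq ι] in
lemma tensorPowerPerm_tprod (π : Equiv.Perm ι) (a : ι → A) :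
    tensorPowerPerm F A π (PiTensorProduct.tprod F a)
      = PiTensorProduct.tprod F fun i => a (π.symm i) := by
  simp [tensorPowerPerm]

lemma tensorPowerRep_tensorPowerPerm (f : A →ₐ[F] Matrix α α L) (π : Equiv.Perm ι)
    (t : ⨂[F] _ : ι, A) (x y : ι → α) :
    tensorPowerRep ι f (tensorPowerPerm F A π t) x y
      = tensorPowerRep ι f t (x ∘ ⇑π) (y ∘ ⇑π) := by
  induction t using PiTensorProduct.induction_on with
  | smul_tprod r a =>
    rw [map_smul, map_smul, map_smul, tensorPowerPerm_tprod, Matrix.smul_apply, Matrix.smul_apply,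
      tensorPowerRep_tprod_apply, tensorPowerRep_tprod_apply]
    congr 1
    refine Fintype.prod_equiv π.symm _ _ fun i => ?_
    simp
  | add u v hu hv => rw [map_add, map_add, map_add, Matrix.add_apply, Matrix.add_apply, hu, hv]

lemma finrank_piTensorProduct_const [FiniteDimensional F A] :
    finrank F (⨂[F] _ : ι, A) = finrank F A ^ Fintype.card ι := by
  rw [finrank_eq_card_basis (Basis.piTensorProduct fun _ : ι => finBasis F A)]
  simp

end TensorPower

section FrobeniusDescent

open scoped Matrix

variable {F L A : Type*} [Field F] [Field L] [Algebra F L] [Ring A] [Algebra F A] {ι α n : Type*}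
  [Fintype ι] [DecidableEq ι] [Fintype α] [DecidableEq α] [Fintype n] [DecidableEq n] [Nonempty ι]
  [Nonempty α] {p : ℕ}

omit [Nonempty ι] in
/-- The cyclic permutation of the factors of a split tensor power is given over the base field by a
matrix that becomes the permutation matrix over a splitting field. -/
lemma exists_matrix_tensorPowerPerm {π : Equiv.Perm ι} (hπ : π ^ p = 1)
    (hA : finrank F A = Fintype.card α ^ 2) (f : A →ₐ[F] Matrix α α L)
    (h : (⨂[F] _ : ι, A) ≃ₐ[F] Matrix n n F)
    (hc : ∀ c : L, c ^ p ∈ Set.range (algebraMap F L) → c ∈ Set.range (algebraMap F L))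
    {P : Matrix (ι → α) (ι → α) L} (hP : ∀ v x, (P *ᵥ v) x = v (x ∘ ⇑π)) :
    ∃ (s : Matrix n n F) (Q : Matrix (ι → α) n L) (R : Matrix n (ι → α) L),
      Q * R = 1 ∧ R * Q = 1 ∧ s.map (algebraMap F L) = R * P * Q ∧
      (∀ t, tensorPowerRep ι f t = Q * (h t).map (algebraMap F L) * R) ∧
      ∀ t, s * h t = h (tensorPowerPerm F A π t) * s := by
  have hαpos : 0 < Fintype.card α := Fintype.card_pos
  have : FiniteDimensional F A := FiniteDimensional.of_finrank_pos (by rw [hA]; positivity)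
  have hT : finrank F (⨂[F] _ : ι, A) = Fintype.card n ^ 2 := by
    rw [h.toLinearEquiv.finrank_eq, finrank_matrix]
    simp [sq]
  have hcard : Fintype.card n = Fintype.card (ι → α) := by
    rw [finrank_piTensorProduct_const, hA, ← pow_mul, mul_comm 2, pow_mul] at hT
    rw [Fintype.card_fun]
    exact (Nat.pow_left_injective (two_ne_zero) hT).symm
  have : Nonempty n := by
    rw [← Fintype.card_pos_iff, hcard]
    exact Fintype.card_pos
  let h' : (⨂[F] _ : ι, A) →ₐ[F] Matrix n n L :=
    ((Algebra.ofId F L).mapMatrix).comp h.toAlgHom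
  have hh' : ∀ t, h' t = (h t).map (algebraMap F L) := fun t => rfl
  have hspan : Submodule.span L (Set.range h') = ⊤ := span_range_map_algebraMap_eq_top h
  obtain ⟨Q, R, hQR, hRQ, hg⟩ :=
    exists_conj_of_span_range_eq_top h' hspan hT hcard (tensorPowerRep ι f)
  let σ := tensorPowerPerm F A π
  have hspanF : Submodule.span F (Set.range h.toAlgHom) = ⊤ := by
    have : Set.range h.toAlgHom = Set.univ := h.surjective.range_eq
    rw [this, Submodule.span_univ]
  obtain ⟨s, s', hss', hs's, hs⟩ :=
    exists_conj_of_span_range_eq_top h.toAlgHom hspanF hT rfl (h.toAlgHom.comp σ)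
  have hs1 : ∀ t, h (σ t) * s = s * h t := fun t => by
    have : h (σ t) = s * h t * s' := hs t
    rw [this, mul_assoc, hs's, mul_one]
  have hs2 : ∀ t, h t * s' = s' * h (σ t) := fun t => by
    have : h (σ t) = s * h t * s' := hs t
    rw [this, ← mul_assoc, ← mul_assoc, hs's, one_mul]
  have hPg : ∀ t, P * tensorPowerRep ι f t = tensorPowerRep ι f (σ t) * P := by
    intro t
    refine Matrix.ext_of_mulVec_single fun y => ?_
    funext x
    rw [← Matrix.mulVec_mulVec, ← Matrix.mulVec_mulVec, hP, Matrix.mulVec_single_one]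
    have hPs : P *ᵥ Pi.single y 1 = Pi.single (y ∘ ⇑π.symm) 1 := by
      funext z
      rw [hP, Pi.single_apply, Pi.single_apply]
      congr 1
      rw [eq_iff_iff]
      constructor
      · rintro rfl
        funext i
        simp
      · rintro rfl
        funext i
        simp
    rw [hPs, Matrix.mulVec_single_one]
    have hy : (y ∘ ⇑π.symm) ∘ ⇑π = y := by
      funext i
      simp
    simp only [Matrix.col_apply, σ, tensorPowerRep_tensorPowerPerm, hy]
  have hRP : ∀ t, (R * P * Q) * h' t = h' (σ t) * (R * P * Q) := by
    intro t
    calc (R * P * Q) * h' t = R * (P * (Q * h' t * R)) * Q := by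
          simp only [Matrix.mul_assoc, hRQ, Matrix.mul_one]
      _ = R * ((Q * h' (σ t) * R) * P) * Q := by rw [← hg, hPg, hg]
      _ = (R * Q) * h' (σ t) * (R * P * Q) := by simp only [Matrix.mul_assoc]
      _ = h' (σ t) * (R * P * Q) := by rw [hRQ, Matrix.one_mul]
  let S := s.map (algebraMap F L)
  let S' := s'.map (algebraMap F L)
  have hSS' : S * S' = 1 := by
    rw [← Matrix.map_mul, hss', Matrix.map_one _ (map_zero _) (map_one _)]
  obtain ⟨c, hcS⟩ : ∃ c, S' * (R * P * Q) = Matrix.scalar n c := by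
    refine exists_scalar_of_commute hspan ?_
    rintro _ ⟨t, rfl⟩
    rw [mul_assoc, hRP, ← mul_assoc, ← mul_assoc]
    congr 1
    rw [hh', hh', ← Matrix.map_mul, ← Matrix.map_mul, hs2]
  have hcS' : R * P * Q = c • S := by
    rw [← one_mul (R * P * Q), ← hSS', mul_assoc, hcS]
    simp [Matrix.smul_eq_mul_diagonal]
  have hPp : P ^ p = 1 := by
    refine Matrix.ext_of_mulVec_single fun y => ?_
    funext x
    rw [pow_mulVec_apply_of_mulVec_apply hP, hπ, Matrix.one_mulVec]
    rfl
  have hRPk : ∀ k, (R * P * Q) ^ k = R * P ^ k * Q := by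
    intro k
    induction k with
    | zero => simp [hRQ]
    | succ k ih =>
      rw [pow_succ, ih, pow_succ]
      calc R * P ^ k * Q * (R * P * Q) = R * P ^ k * (Q * R) * P * Q := by
            simp only [Matrix.mul_assoc]
        _ = R * (P ^ k * P) * Q := by rw [hQR, Matrix.mul_one]; simp only [Matrix.mul_assoc]
  have hcp : c ^ p ∈ Set.range (algebraMap F L) := by
    have h1 : c ^ p • S ^ p = 1 := by
      rw [← smul_pow, ← hcS', hRPk, hPp, Matrix.mul_one, hRQ]
    have h2 : S ^ p = (s ^ p).map (algebraMap F L) :=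
      (map_pow (algebraMap F L).mapMatrix s p).symm
    let i : n := Classical.arbitrary n
    have h3 := congrFun (congrFun h1 i) i
    rw [h2, Matrix.smul_apply, Matrix.map_apply, Matrix.one_apply_eq, smul_eq_mul] at h3
    refine ⟨((s ^ p) i i)⁻¹, ?_⟩
    rw [map_inv₀]
    exact (eq_inv_of_mul_eq_one_left h3).symm
  obtain ⟨c₀, rfl⟩ := hc c hcp
  refine ⟨c₀ • s, Q, R, hQR, hRQ, ?_, hg, fun t => ?_⟩
  · rw [hcS']
    ext i j
    simp [S]
  · rw [Matrix.smul_mul, Matrix.mul_smul, hs1]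

omit [Nonempty α] in
lemma map_pow_mulVec_mem_diagonalFixed [CharP L p] (hp : p.Prime) (hpι : Fintype.card ι = p)
    {π : Equiv.Perm ι} (hπ : π ^ p = 1) (htrans : ∀ i j, ∃ k : ℕ, (π ^ k) i = j)
    (f : A →ₐ[F] Matrix α α L) (h : (⨂[F] _ : ι, A) ≃ₐ[F] Matrix n n F)
    {P : Matrix (ι → α) (ι → α) L} (hP : ∀ v x, (P *ᵥ v) x = v (x ∘ ⇑π))
    {s : Matrix n n F} {Q : Matrix (ι → α) n L} {R : Matrix n (ι → α) L} (hQR : Q * R = 1)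
    (hRQ : R * Q = 1) (hs : s.map (algebraMap F L) = R * P * Q)
    (hg : ∀ t, tensorPowerRep ι f t = Q * (h t).map (algebraMap F L) * R)
    (hst : ∀ t, s * h t = h (tensorPowerPerm F A π t) * s) (a : A) {w : α → L}
    (hw : w ∈ diagonalFixed s Q) : (f a).map (· ^ p) *ᵥ w ∈ diagonalFixed s Q := by
  obtain ⟨x, hx, rfl⟩ := hw
  let t : ⨂[F] _ : ι, A := PiTensorProduct.tprod F fun _ => a
  refine ⟨h t *ᵥ x, ?_, ?_⟩
  · rw [Matrix.mulVec_mulVec, hst, tensorPowerPerm_tprod, ← Matrix.mulVec_mulVec, hx]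
  set v := Q *ᵥ (algebraMap F L ∘ x) with hv
  have hvinv : ∀ y, v (y ∘ ⇑π) = v y := by
    intro y
    have hx' : s.map (algebraMap F L) *ᵥ (algebraMap F L ∘ x) = algebraMap F L ∘ x := by
      conv_rhs => rw [← hx]
      funext j
      exact (RingHom.map_mulVec (algebraMap F L) s x j).symm
    rw [← hP v y, hv, Matrix.mulVec_mulVec]
    conv_rhs => rw [← hx', hs, Matrix.mulVec_mulVec, Matrix.mul_assoc R, ← Matrix.mul_assoc, hQR,
      Matrix.one_mul]
  have h1 : Q *ᵥ (algebraMap F L ∘ (h t *ᵥ x)) = tensorPowerRep ι f t *ᵥ v := by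
    have h2 : algebraMap F L ∘ (h t *ᵥ x)
        = (h t).map (algebraMap F L) *ᵥ (algebraMap F L ∘ x) := by
      funext j
      exact RingHom.map_mulVec (algebraMap F L) (h t) x j
    rw [h2, hg, hv, Matrix.mulVec_mulVec, Matrix.mulVec_mulVec, Matrix.mul_assoc _ R Q, hRQ,
      Matrix.mul_one]
  rw [h1]
  funext i
  simp only [Function.comp_apply, Matrix.mulVec, dotProduct]
  rw [sum_eq_sum_const_of_comp_eq hp hπ htrans
    (fun y => tensorPowerRep ι f t (Function.const ι i) y * v y)]
  · refine Finset.sum_congr rfl fun b _ => ?_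
    simp [t, tensorPowerRep_tprod_apply, hpι]
  · intro y
    simp only [t, tensorPowerRep_tprod_apply, hvinv]
    congr 1
    exact Fintype.prod_equiv π _ _ fun _ => rfl

/-- If the `p`-th tensor power of `A` is split, then the Frobenius twist of `A` is split. -/
lemma exists_isUnit_map_pow_mul_eq [FiniteDimensional F L] [CharP L p] (hp : p.Prime)
    (hA : finrank F A = Fintype.card α ^ 2) (f : A →ₐ[F] Matrix α α L)
    (h : (⨂[F] _ : Fin p, A) ≃ₐ[F] Matrix n n F)
    (hc : ∀ c : L, c ^ p ∈ Set.range (algebraMap F L) → c ∈ Set.range (algebraMap F L)) :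
    ∃ S : Matrix α α L, IsUnit S ∧ ∀ a, ∃ m : Matrix α α F,
      (f a).map (· ^ p) * S = S * m.map (algebraMap F L) := by
  have : Nonempty (Fin p) := ⟨⟨0, hp.pos⟩⟩
  obtain ⟨π, hπ, htrans⟩ := exists_perm_fin_pow_eq_one hp
  let P : Matrix (Fin p → α) (Fin p → α) L :=
    (1 : Matrix (Fin p → α) (Fin p → α) L).submatrix (fun x => x ∘ ⇑π) id
  have hP : ∀ v x, (P *ᵥ v) x = v (x ∘ ⇑π) := by
    intro v x
    have := congrFun (Matrix.one_mulVec v) (x ∘ ⇑π)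
    exact this
  obtain ⟨s, Q, R, hQR, hRQ, hs, hg, hst⟩ :=
    exists_matrix_tensorPowerPerm hπ hA f h hc hP
  obtain ⟨b, hb⟩ := exists_basis_of_linearIndependent_of_span_eq_top (Pi.basisFun L α)
    (diagonalFixed s Q) (span_diagonalFixed_eq_top hP hQR hs)
    (fun J w => linearIndependent_of_mem_diagonalFixed hp hπ htrans hP hQR hRQ hs w)
  let S : Matrix α α L := Matrix.of fun i j => b j i
  refine ⟨S, ?_, fun a => ?_⟩
  · rw [← Matrix.linearIndependent_cols_iff_isUnit]
    exact b.linearIndependent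
  · have hmem : ∀ j, (f a).map (· ^ p) *ᵥ b j ∈ Submodule.span F (Set.range b) := by
      intro j
      rw [← hb]
      refine map_pow_mulVec_mem_diagonalFixed hp (Fintype.card_fin p) hπ htrans f h hP hQR hRQ hs
        hg hst a ?_
      rw [hb]
      exact Submodule.subset_span ⟨j, rfl⟩
    simp only [Submodule.mem_span_range_iff_exists_fun] at hmem
    choose m hm using hmem
    refine ⟨Matrix.of fun i j => m j i, ?_⟩
    ext i j
    have h1 := congrFun (hm j) i
    rw [Finset.sum_apply] at h1
    simp only [Pi.smul_apply] at h1
    simp only [Matrix.mul_apply, Matrix.map_apply, Matrix.of_apply, S, mul_comm (b _ i),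
      ← Algebra.smul_def]
    exact h1.symm

end FrobeniusDescent

section ExponentP

variable {F L Ω A : Type*} [Field F] [Field L] [Field Ω] [Algebra F L] [Algebra F Ω] [Algebra L Ω]
  [IsScalarTower F L Ω] [Ring A] [Algebra F A] {p d : ℕ} [Fact p.Prime] [CharP Ω p] [IsAlgClosed Ω]

/-- If the Frobenius twist of `A` is split over `F`, then `A` is split by `p`-th roots of elements
of `F`. -/
lemma splitsOver_pthRoots_bot (hd : 0 < d) (hA : finrank F A = d ^ 2)
    {N : IntermediateField F Ω} (hN : SplitsOver A d N) (f : A →ₐ[F] Matrix (Fin d) (Fin d) L)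
    {S : Matrix (Fin d) (Fin d) L} (hS : IsUnit S)
    (hf : ∀ a, ∃ m : Matrix (Fin d) (Fin d) F,
      (f a).map (· ^ p) * S = S * m.map (algebraMap F L)) :
    SplitsOver A d (pthRoots p (⊥ : IntermediateField F Ω)) := by
  have hp : p.Prime := Fact.out
  let j : L →ₐ[F] Ω := IsScalarTower.toAlgHom F L Ω
  let f' : A →ₐ[F] Matrix (Fin d) (Fin d) Ω := j.mapMatrix.comp f
  let φ : Matrix (Fin d) (Fin d) Ω →+* Matrix (Fin d) (Fin d) Ω := (frobenius Ω p).mapMatrix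
  choose r hr using fun x : Ω => IsAlgClosed.exists_pow_nat_eq x hp.pos
  let S₀ : Matrix (Fin d) (Fin d) Ω := j.mapMatrix S
  let S₁ : Matrix (Fin d) (Fin d) Ω := S₀.map r
  have hS₀ : IsUnit S₀ := hS.map j.mapMatrix
  have hφS : φ S₁ = S₀ := by
    ext i k
    exact hr _
  have hS₁ : IsUnit S₁ := by
    rw [Matrix.isUnit_iff_isUnit_det, isUnit_iff_ne_zero] at hS₀ ⊢
    intro h0
    apply hS₀
    rw [← hφS]
    have := RingHom.map_det (frobenius Ω p) S₁
    rw [h0, map_zero] at this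
    exact this.symm
  obtain ⟨u, hu⟩ := hS₁
  let g : A →ₐ[F] Matrix (Fin d) (Fin d) Ω :=
    AlgHom.ofLinearMap
      (LinearMap.mulRight F (u : Matrix (Fin d) (Fin d) Ω) ∘ₗ
        LinearMap.mulLeft F ((u⁻¹ : (Matrix (Fin d) (Fin d) Ω)ˣ) : Matrix (Fin d) (Fin d) Ω) ∘ₗ
        f'.toLinearMap)
      (by simp)
      (by
        intro a b
        simp [mul_assoc])
  have hg : ∀ a, S₁ * g a = f' a * S₁ := by
    intro a
    rw [← hu]
    change (u : Matrix (Fin d) (Fin d) Ω) *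
      (((u⁻¹ : (Matrix (Fin d) (Fin d) Ω)ˣ) : Matrix (Fin d) (Fin d) Ω) * f' a * u) = _
    rw [← mul_assoc, Units.mul_inv_cancel_left]
  refine hN.of_algHom hd hA g fun a i k => ?_
  obtain ⟨m, hm⟩ := hf a
  have h1 := congrArg φ (hg a)
  rw [map_mul, map_mul, hφS] at h1
  have h2 : φ (f' a) = j.mapMatrix ((f a).map (· ^ p)) := by
    ext i k
    exact (map_pow j (f a i k) p).symm
  rw [h2, ← map_mul, hm, map_mul] at h1
  have h3 := congrFun (congrFun (hS₀.mul_left_cancel h1) i) k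
  rw [mem_pthRoots, IntermediateField.mem_bot]
  refine ⟨m i k, ?_⟩
  have h4 : (g a i k) ^ p = j (algebraMap F L (m i k)) := h3
  rw [h4, AlgHom.commutes]

end ExponentP

/-- If `A` is central simple of exponent `p` over `F` of characteristic `p`
and `A` splits over a `p`-extension of `F` of degree `p ^ n`, then
`λ_p(A) ≤ 2 * p ^ (n - 1) - 1`. -/
theorem statement13 (p : ℕ) (hp : p.Prime) (F : Type) [Field F] [CharP F p]
    (A : Type) [Ring A] [Algebra F A] (hA : IsCSA F A) (hexp : HasExponent F A p)
    (n : ℕ) (hn : 0 < n)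
    (hsplit : ∃ (L : Type) (_ : Field L) (_ : Algebra F L), IsPExtension p F L ∧
      Module.finrank F L = p ^ n ∧ IsSplitAlg L (L ⊗[F] A)) :
    SymbolLengthLE p F A (2 * p ^ (n - 1) - 1) := by
  obtain ⟨L, _, _, hL, hfin, d, hd, ⟨e⟩⟩ := hsplit
  obtain ⟨-, ⟨N, hN, ⟨h⟩⟩, -⟩ := hexp
  have : Fact p.Prime := ⟨hp⟩
  have : FiniteDimensional F A := hA.2.2
  have : FiniteDimensional F L := FiniteDimensional.of_finrank_pos (hfin ▸ pow_pos hp.pos n)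
  have : CharP L p := charP_of_injective_algebraMap (algebraMap F L).injective p
  let Ω := AlgebraicClosure L
  have : CharP Ω p := charP_of_injective_algebraMap (algebraMap F Ω).injective p
  have : Algebra.IsAlgebraic F Ω := Algebra.IsAlgebraic.trans F L Ω
  have hne : Nonempty (Fin d) := ⟨⟨0, hd⟩⟩
  have hdim : finrank F A = d ^ 2 := by
    rw [← finrank_baseChange (R := L), e.toLinearEquiv.finrank_eq, finrank_matrix]
    simp [sq]
  let f : A →ₐ[F] Matrix (Fin d) (Fin d) L :=
    (e.toAlgHom.restrictScalars F).comp Algebra.TensorProduct.includeRight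
  have hf : Submodule.span L (Set.range f) = ⊤ := by
    rw [eq_top_iff]
    intro M _
    obtain ⟨x, rfl⟩ := e.surjective M
    induction x using TensorProduct.induction_on with
    | zero => rw [map_zero]; exact zero_mem _
    | tmul c a =>
      have : e (c ⊗ₜ a) = c • f a := by
        rw [show f a = e (1 ⊗ₜ a) from rfl, ← map_smul, TensorProduct.smul_tmul', smul_eq_mul,
          mul_one]
      rw [this]
      exact Submodule.smul_mem _ _ (Submodule.subset_span ⟨a, rfl⟩)
    | add x y hx hy => rw [map_add]; exact add_mem (hx trivial) (hy trivial)
  obtain ⟨T, hT0, hTn, hT⟩ := hL.exists_chain hfin (Ω := Ω)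
  have hsplitT : SplitsOver A d (T n) := by
    rw [hTn]
    exact (splitsOver_fieldRange_iff hd hdim _).2 ⟨f, hf⟩
  have hc : ∀ c : L, c ^ p ∈ Set.range (algebraMap F L) → c ∈ Set.range (algebraMap F L) := by
    rintro c ⟨b, hb⟩
    have hcT : algebraMap L Ω c ∈ T n := by
      rw [hTn]
      exact ⟨c, rfl⟩
    obtain ⟨a, ha⟩ := IntermediateField.mem_bot.1
      (mem_bot_of_pow_mem_bot_of_chain hT0 hT hcT (IntermediateField.mem_bot.2
        ⟨b, by rw [← map_pow, ← hb, ← IsScalarTower.algebraMap_apply]⟩))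
    refine ⟨a, (algebraMap L Ω).injective ?_⟩
    rw [← ha, ← IsScalarTower.algebraMap_apply]
  obtain ⟨S, hS, hfS⟩ := exists_isUnit_map_pow_mul_eq hp (by simpa using hdim) f h hc
  obtain ⟨s, hsc, hsp, hs⟩ := splitsOverRoots_bot_of_chain hd hdim hT0 hn hT hsplitT
    (splitsOver_pthRoots_bot hd hdim hsplitT f hS hfS)
  rw [bot_sup_eq] at hs
  exact symbolLengthLE_of_splitsOver_adjoin hp s A d _ hd hdim
    (fun x hx => (IntermediateField.mem_bot.1 (hsp x hx)).imp fun _ h => h.symm) hs hsc
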